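/- There exist constants 0 < c ≤ C < ∞ such that for every integer n ≥ 1 and every integer 1 ≤ m ≤ n, c·m/n ≤ P(M_n < m) ≤ C·m/n. -/

import Mathlib

/-!
Critical site percolation on the triangular lattice realized on `ℤ²`.
A configuration assigns to each site `true` (open) or `false` (closed),
and `P` is the product Bernoulli(1/2) measure, axiomatized by
`IsBernoulliHalf` below (finite cylinder events have product probability).
-/

open MeasureTheory
open scoped ENNReal

/-- Sites of the lattice: vertices of `ℤ²`. -/
abbrev Site : Type := ℤ × ℤ

/-- A percolation configuration: `true` = open, `false` = closed. -/
abbrev Config : Type := Site → Bool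

/-- Adjacency for the triangular lattice realized on `ℤ²`:
the neighbors of `(x,y)` are `(x±1,y)`, `(x,y±1)`, `(x+1,y-1)`, `(x-1,y+1)`. -/
def Adj (a b : Site) : Prop :=
  (b.1 - a.1, b.2 - a.2) ∈
    ({(1, 0), (-1, 0), (0, 1), (0, -1), (1, -1), (-1, 1)} : Set (ℤ × ℤ))

/-- A (nonempty, self-avoiding) lattice path: a list of distinct sites in which
consecutive sites are neighbors. -/
def IsPath (p : List Site) : Prop := p ≠ [] ∧ p.Nodup ∧ p.Chain' Adj

/-- A path all of whose vertices lie in the set `S`. -/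
def PathIn (S : Set Site) (p : List Site) : Prop := IsPath p ∧ ∀ v ∈ p, v ∈ S

/-- All sites of `p` are open in `ω`. -/
def IsOpenOn (ω : Config) (p : List Site) : Prop := ∀ v ∈ p, ω v = true

/-- All sites of `p` are closed in `ω`. -/
def IsClosedOn (ω : Config) (p : List Site) : Prop := ∀ v ∈ p, ω v = false

/-- The first vertex of `p` lies in `A`. -/
def FirstIn (A : Set Site) (p : List Site) : Prop := ∃ a ∈ A, p.head? = some a

/-- The last vertex of `p` lies in `A`. -/
def LastIn (A : Set Site) (p : List Site) : Prop := ∃ a ∈ A, p.getLast? = some a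

/-- `μ` is the product Bernoulli(1/2) measure on configurations: a probability
measure for which every finite cylinder event has the product probability. -/
def IsBernoulliHalf (μ : Measure Config) : Prop :=
  IsProbabilityMeasure μ ∧
    ∀ (S : Finset Site) (f : Site → Bool),
      μ {ω | ∀ v ∈ S, ω v = f v} = (1 / 2 : ℝ≥0∞) ^ S.card

/-- The lattice rectangle `[x₀,x₁] × [y₀,y₁]`. -/
def rect (x₀ x₁ y₀ y₁ : ℤ) : Set Site :=
  {v | x₀ ≤ v.1 ∧ v.1 ≤ x₁ ∧ y₀ ≤ v.2 ∧ v.2 ≤ y₁}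

/-- The left side of a rectangle. -/
def rectLeft (x₀ x₁ y₀ y₁ : ℤ) : Set Site := {v ∈ rect x₀ x₁ y₀ y₁ | v.1 = x₀}

/-- The right side of a rectangle. -/
def rectRight (x₀ x₁ y₀ y₁ : ℤ) : Set Site := {v ∈ rect x₀ x₁ y₀ y₁ | v.1 = x₁}

/-- The top side of a rectangle. -/
def rectTop (x₀ x₁ y₀ y₁ : ℤ) : Set Site := {v ∈ rect x₀ x₁ y₀ y₁ | v.2 = y₁}

/-- The bottom side of a rectangle. -/
def rectBot (x₀ x₁ y₀ y₁ : ℤ) : Set Site := {v ∈ rect x₀ x₁ y₀ y₁ | v.2 = y₀}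

/-- A horizontal open crossing of the rectangle `[x₀,x₁] × [y₀,y₁]`:
an open path in the rectangle from its left side to its right side. -/
def HorizCrossing (x₀ x₁ y₀ y₁ : ℤ) (ω : Config) (p : List Site) : Prop :=
  PathIn (rect x₀ x₁ y₀ y₁) p ∧ IsOpenOn ω p ∧
    FirstIn (rectLeft x₀ x₁ y₀ y₁) p ∧ LastIn (rectRight x₀ x₁ y₀ y₁) p

/-- `v` is a pivotal site for the box `B(n) = [-n,n]²`: some horizontal open
crossing of `B(n)` contains `v`, and there are two disjoint closed paths in
`B(n)` started from `v` (i.e. starting at a neighbor of `v`), one to the top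
side and one to the bottom side of `B(n)`. -/
def Pivotal (n : ℤ) (ω : Config) (v : Site) : Prop :=
  (∃ p, HorizCrossing (-n) n (-n) n ω p ∧ v ∈ p) ∧
    ∃ q₁ q₂ : List Site,
      PathIn (rect (-n) n (-n) n) q₁ ∧ IsClosedOn ω q₁ ∧
        FirstIn {w | Adj v w} q₁ ∧ LastIn (rectTop (-n) n (-n) n) q₁ ∧
      PathIn (rect (-n) n (-n) n) q₂ ∧ IsClosedOn ω q₂ ∧
        FirstIn {w | Adj v w} q₂ ∧ LastIn (rectBot (-n) n (-n) n) q₂ ∧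
      List.Disjoint q₁ q₂

/-- `Q_n`: the set of pivotal sites for `B(n)`. -/
def Qset (n : ℤ) (ω : Config) : Set Site := {v | Pivotal n ω v}

/-- `M_n`: the minimum height above the bottom of `B(n)` attained by a pivotal
site, when one exists; `2n` otherwise. -/
noncomputable def Mn (n : ℕ) (ω : Config) : ℕ := by
  classical
  exact if (Qset (n : ℤ) ω).Nonempty then
      sInf {h : ℕ | ∃ x : ℤ, (x, -(n : ℤ) + (h : ℤ)) ∈ Qset (n : ℤ) ω}
    else 2 * n

theorem adj_iff {a b : Site} : Adj a b ↔
    (b.1 = a.1 + 1 ∧ b.2 = a.2) ∨ (b.1 = a.1 - 1 ∧ b.2 = a.2) ∨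
    (b.1 = a.1 ∧ b.2 = a.2 + 1) ∨ (b.1 = a.1 ∧ b.2 = a.2 - 1) ∨
    (b.1 = a.1 + 1 ∧ b.2 = a.2 - 1) ∨ (b.1 = a.1 - 1 ∧ b.2 = a.2 + 1) := by
  simp only [Adj, Set.mem_insert_iff, Set.mem_singleton_iff, Prod.mk.injEq]
  omega

theorem Adj.symm {a b : Site} (h : Adj a b) : Adj b a := by
  rw [adj_iff] at *
  omega

/-- `a` and `b` are joined by a lattice walk inside `A`. -/
def Conn (A : Set Site) (a b : Site) : Prop :=
  a ∈ A ∧ Relation.ReflTransGen (fun u v => Adj u v ∧ v ∈ A) a b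

namespace Conn

variable {A B F : Set Site} {a b c : Site}

theorem refl (h : a ∈ A) : Conn A a a := ⟨h, .refl⟩

theorem left_mem (h : Conn A a b) : a ∈ A := h.1

theorem right_mem (h : Conn A a b) : b ∈ A := by
  obtain ⟨ha, h⟩ := h
  cases h with
  | refl => exact ha
  | tail _ h => exact h.2

theorem step (h : Conn A a b) (hbc : Adj b c) (hc : c ∈ A) : Conn A a c :=
  ⟨h.1, h.2.tail ⟨hbc, hc⟩⟩

theorem trans (h : Conn A a b) (h' : Conn A b c) : Conn A a c := ⟨h.1, h.2.trans h'.2⟩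

theorem single (ha : a ∈ A) (hab : Adj a b) (hb : b ∈ A) : Conn A a b := (refl ha).step hab hb

/-- Induction along a walk, extending it at its end. -/
theorem rec_on {P : Site → Prop} (h : Conn A a b) (h0 : P a)
    (hs : ∀ u v, Conn A a u → Adj u v → v ∈ A → P u → P v) : P b := by
  obtain ⟨ha, h⟩ := h
  induction h with
  | refl => exact h0
  | tail h1 h2 ih => exact hs _ _ ⟨ha, h1⟩ h2.1 h2.2 ih

theorem symm (h : Conn A a b) : Conn A b a :=
  h.rec_on (P := fun b => Conn A b a) (refl h.1)
    fun _ _ hu huv hv ih => (single hv huv.symm hu.right_mem).trans ih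

theorem mono (h : Conn A a b) (hAB : A ⊆ B) : Conn B a b :=
  h.rec_on (refl (hAB h.1)) fun _ _ _ huv hv ih => ih.step huv (hAB hv)

/-- A walk is a walk inside its own cluster. -/
theorem within (h : Conn A a b) : Conn {v | Conn A a v} a b :=
  h.rec_on (refl (refl h.1)) fun _ _ hu huv hv ih => ih.step huv (hu.step huv hv)

theorem map {f : Site → Site} (hf : ∀ u v, Adj u v → Adj (f u) (f v)) (hA : ∀ v ∈ A, f v ∈ B)
    (h : Conn A a b) : Conn B (f a) (f b) :=
  h.rec_on (P := fun b => Conn B (f a) (f b)) (refl (hA _ h.1))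
    fun _ _ _ huv hv ih => ih.step (hf _ _ huv) (hA _ hv)

/-- A walk started in `F` either stays in `F` or has a first exit. -/
theorem first_exit (h : Conn A a b) (ha : a ∈ F) :
    Conn (A ∩ F) a b ∨ ∃ f z, Conn (A ∩ F) a f ∧ Adj f z ∧ z ∈ A ∧ z ∉ F := by
  refine h.rec_on (P := fun b => Conn (A ∩ F) a b ∨ _) (.inl (refl ⟨h.1, ha⟩)) ?_
  rintro u v hu huv hv (ih | ih)
  · by_cases hF : v ∈ F
    · exact .inl (ih.step huv ⟨hv, hF⟩)
    · exact .inr ⟨u, v, ih, huv, hv, hF⟩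
  · exact .inr ih

theorem exists_exit (h : Conn A a b) (ha : a ∈ F) (hb : b ∉ F) :
    ∃ f z, Conn (A ∩ F) a f ∧ Adj f z ∧ z ∈ A ∧ z ∉ F := by
  rcases h.first_exit ha with h | h
  · exact absurd h.right_mem.2 hb
  · exact h

end Conn

theorem exists_path_of_conn {A : Set Site} {a b : Site} (h : Conn A a b) :
    ∃ p, PathIn A p ∧ p.head? = some a ∧ p.getLast? = some b := by
  refine h.symm.rec_on (P := fun a => ∃ p, PathIn A p ∧ p.head? = some a ∧ p.getLast? = some b)
    ⟨[b], ⟨⟨by simp, by simp, List.isChain_singleton b⟩, by simpa using h.right_mem⟩, by simp,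
      by simp⟩ ?_
  rintro u v hu huv hv ⟨p, ⟨⟨hp0, hp1, hp2⟩, hpA⟩, hph, hpl⟩
  by_cases hvp : v ∈ p
  · obtain ⟨s, t, rfl⟩ := List.append_of_mem hvp
    refine ⟨v :: t, ⟨⟨by simp, ?_, ?_⟩, ?_⟩, by simp, ?_⟩
    · exact (List.nodup_append.1 hp1).2.1
    · exact (List.isChain_append.1 hp2).2.1
    · intro w hw
      exact hpA w (by simp at hw ⊢; tauto)
    · rw [← hpl, List.getLast?_append]
      simp [List.getLast?_cons]
  · refine ⟨v :: p, ⟨⟨by simp, by simp [hvp, hp1], ?_⟩, ?_⟩, by simp, ?_⟩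
    · refine List.isChain_cons.2 ⟨?_, hp2⟩
      rintro y hy
      rw [hph] at hy
      simp at hy
      rw [← hy]
      exact huv.symm
    · simpa [hv] using hpA
    · obtain ⟨x, q, rfl⟩ := List.exists_cons_of_ne_nil hp0
      rw [← hpl, List.getLast?_cons_cons]

theorem conn_of_path {A : Set Site} {a b : Site} {p : List Site} (hp : PathIn A p)
    (ha : p.head? = some a) (hb : p.getLast? = some b) : Conn A a b := by
  obtain ⟨⟨-, -, hc⟩, hA⟩ := hp
  induction p generalizing a with
  | nil => simp at ha
  | cons x t ih =>
    simp at ha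
    subst ha
    cases t with
    | nil =>
      simp at hb
      subst hb
      exact .refl (hA _ (by simp))
    | cons y t =>
      rw [List.getLast?_cons_cons] at hb
      have h := List.isChain_cons_cons.1 hc
      exact (Conn.single (hA _ (by simp)) h.1 (hA _ (by simp))).trans
        (ih (by simp) hb (fun v hv => hA v (List.mem_cons_of_mem _ hv)) h.2)

/-- Vertical segments are connected. -/
theorem conn_vertical {A : Set Site} {x y y' : ℤ} (h : y ≤ y')
    (hA : ∀ t, y ≤ t → t ≤ y' → (x, t) ∈ A) : Conn A (x, y) (x, y') := by
  induction y', h using Int.leInduction with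
  | base => exact .refl (hA _ le_rfl le_rfl)
  | succ z hz ih =>
    exact (ih fun t h1 h2 => hA t h1 (by omega)).step (by rw [adj_iff]; simp)
      (hA _ (by omega) le_rfl)

theorem conn_horizontal {A : Set Site} {y x x' : ℤ} (h : x ≤ x')
    (hA : ∀ t, x ≤ t → t ≤ x' → (t, y) ∈ A) : Conn A (x, y) (x', y) := by
  induction x', h using Int.leInduction with
  | base => exact .refl (hA _ le_rfl le_rfl)
  | succ z hz ih =>
    exact (ih fun t h1 h2 => hA t h1 (by omega)).step (by rw [adj_iff]; simp)
      (hA _ (by omega) le_rfl)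

/-- Indicator, with values in `ZMod 2`, that `v` lies in the row of `s`, strictly to its left. -/
def leftInd (s v : Site) : ZMod 2 := if v.2 = s.2 ∧ v.1 < s.1 then 1 else 0

theorem leftInd_eq_zero {s v : Site} (h : ¬ (v.2 = s.2 ∧ v.1 < s.1)) : leftInd s v = 0 := if_neg h

theorem leftInd_congr {s s' v v' : Site}
    (h : (v.2 = s.2 ∧ v.1 < s.1) ↔ (v'.2 = s'.2 ∧ v'.1 < s'.1)) :
    leftInd s v = leftInd s' v' := by simp only [leftInd, h]

/-- `U` and `G` count modulo 2 the edges of a walk in `A` from `p` to `q` leaving the row of a site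
upwards, resp. downwards, to its left. -/
structure IsParity (A : Set Site) (p q : Site) (U G : Site → ZMod 2) : Prop where
  add_eq : ∀ s, s ∉ A → U s + G s = leftInd s p + leftInd s q
  up : ∀ s s', s ∉ A → s' ∉ A → s'.2 = s.2 + 1 → (s'.1 = s.1 ∨ s'.1 = s.1 - 1) → U s = G s'
  right : ∀ s s', s ∉ A → s' ∉ A → s'.2 = s.2 → s'.1 = s.1 + 1 → G s = G s'
  down_zero : ∀ s, (∀ v ∈ A, s.2 ≤ v.2) → G s = 0
  up_zero : ∀ s, (∀ v ∈ A, v.2 ≤ s.2) → U s = 0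
  left_zero : ∀ s, (∀ v ∈ A, s.1 ≤ v.1) → G s = 0

theorem isParity_edge {A : Set Site} {u v : Site} (hu : u ∈ A) (hv : v ∈ A)
    (h1 : v.2 = u.2 + 1) (h2 : v.1 = u.1 ∨ v.1 = u.1 - 1) :
    IsParity A u v (fun s => leftInd s u) (fun s => leftInd s v) where
  add_eq _ _ := rfl
  up s s' hs hs' h3 h4 := by
    have e1 : s ≠ u := fun h => hs (h ▸ hu)
    have e2 : s' ≠ v := fun h => hs' (h ▸ hv)
    rw [Ne, Prod.ext_iff] at e1 e2
    exact leftInd_congr (by omega)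
  right s s' hs hs' h3 h4 := by
    have e1 : s ≠ v := fun h => hs (h ▸ hv)
    rw [Ne, Prod.ext_iff] at e1
    exact leftInd_congr (by omega)
  down_zero s hs := leftInd_eq_zero (by have := hs u hu; omega)
  up_zero s hs := leftInd_eq_zero (by have := hs v hv; omega)
  left_zero s hs := leftInd_eq_zero (by have := hs v hv; omega)

theorem IsParity.symm {A : Set Site} {p q : Site} {U G : Site → ZMod 2} (h : IsParity A p q U G) :
    IsParity A q p U G :=
  { h with add_eq := fun s hs => by rw [h.add_eq s hs, add_comm] }

theorem IsParity.trans {A : Set Site} {p q r : Site} {U G U' G' : Site → ZMod 2}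
    (h : IsParity A p q U G) (h' : IsParity A q r U' G') :
    IsParity A p r (fun s => U s + U' s) (fun s => G s + G' s) where
  add_eq s hs := by
    have := h.add_eq s hs
    have := h'.add_eq s hs
    have e : leftInd s q + leftInd s q = 0 := CharTwo.add_self_eq_zero _
    linear_combination h.add_eq s hs + h'.add_eq s hs + e
  up s s' hs hs' h3 h4 := by rw [h.up s s' hs hs' h3 h4, h'.up s s' hs hs' h3 h4]
  right s s' hs hs' h3 h4 := by rw [h.right s s' hs hs' h3 h4, h'.right s s' hs hs' h3 h4]
  down_zero s hs := by rw [h.down_zero s hs, h'.down_zero s hs, add_zero]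
  up_zero s hs := by rw [h.up_zero s hs, h'.up_zero s hs, add_zero]
  left_zero s hs := by rw [h.left_zero s hs, h'.left_zero s hs, add_zero]

theorem isParity_horizontal {A : Set Site} {u v : Site} (hu : u ∈ A) (hv : v ∈ A)
    (h1 : v.2 = u.2) (h2 : v.1 = u.1 + 1 ∨ v.1 = u.1 - 1) :
    IsParity A u v (fun _ => 0) (fun _ => 0) where
  add_eq s hs := by
    have e1 : s ≠ u := fun h => hs (h ▸ hu)
    have e2 : s ≠ v := fun h => hs (h ▸ hv)
    rw [Ne, Prod.ext_iff] at e1 e2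
    rw [leftInd_congr (s := s) (s' := s) (v := u) (v' := v) (by omega), CharTwo.add_self_eq_zero,
      CharTwo.add_self_eq_zero]
  up _ _ _ _ _ _ := rfl
  right _ _ _ _ _ _ := rfl
  down_zero _ _ := rfl
  up_zero _ _ := rfl
  left_zero _ _ := rfl

theorem exists_isParity {A : Set Site} {p q : Site} (h : Conn A p q) :
    ∃ U G, IsParity A p q U G := by
  refine h.rec_on (P := fun q => ∃ U G, IsParity A p q U G)
    ⟨fun _ => 0, fun _ => 0, ?_, ?_, ?_, ?_, ?_, ?_⟩ ?_
  · intro s _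
    rw [CharTwo.add_self_eq_zero, CharTwo.add_self_eq_zero]
  any_goals intros; rfl
  rintro u v hu huv hv ⟨U, G, hUG⟩
  have hu := hu.right_mem
  rw [adj_iff] at huv
  rcases huv with h | h | h | h | h | h
  · exact ⟨_, _, hUG.trans (isParity_horizontal hu hv (by omega) (by omega))⟩
  · exact ⟨_, _, hUG.trans (isParity_horizontal hu hv (by omega) (by omega))⟩
  · exact ⟨_, _, hUG.trans (isParity_edge hu hv (by omega) (by omega))⟩
  · exact ⟨_, _, hUG.trans (isParity_edge hv hu (by omega) (by omega)).symm⟩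
  · exact ⟨_, _, hUG.trans (isParity_edge hv hu (by omega) (by omega)).symm⟩
  · exact ⟨_, _, hUG.trans (isParity_edge hu hv (by omega) (by omega))⟩

/-- `S` is a right side of a walk in `A` crossing a strip from `p` in its bottom row to `q` in its
top row. -/
structure IsRightSide (A : Set Site) (p q : Site) (S : Set Site) : Prop where
  adj_iff : ∀ s s', Adj s s' → s ∉ A → s' ∉ A → p.2 ≤ s.2 → p.2 ≤ s'.2 → s.2 ≤ q.2 → s'.2 ≤ q.2 →
    (s ∈ S ↔ s' ∈ S)
  bot : ∀ s, s ∉ A → s.2 = p.2 → (s ∈ S ↔ p.1 < s.1)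
  top : ∀ s, s ∉ A → s.2 = q.2 → (s ∈ S ↔ q.1 < s.1)
  left : ∀ s, s ∉ A → (∀ v ∈ A, s.1 ≤ v.1) → s ∉ S
  right : ∀ s, s ∉ A → p.2 ≤ s.2 → s.2 ≤ q.2 → (∀ v ∈ A, v.1 ≤ s.1) → s ∈ S

theorem exists_isRightSide {A : Set Site} {p q : Site} (h : Conn A p q)
    (hA : ∀ v ∈ A, p.2 ≤ v.2 ∧ v.2 ≤ q.2) : ∃ S, IsRightSide A p q S := by
  obtain ⟨U, G, hUG⟩ := exists_isParity h
  have hp := h.left_mem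
  have hq := h.right_mem
  have hadj : ∀ s s', Adj s s' → s ∉ A → s' ∉ A → p.2 ≤ s.2 → p.2 ≤ s'.2 → s.2 ≤ q.2 → s'.2 ≤ q.2 →
      G s + leftInd s p = G s' + leftInd s' p := by
    have hz : ∀ s s', s ∉ A → s' ∉ A → s'.2 = s.2 → s'.1 = s.1 + 1 →
        G s + leftInd s p = G s' + leftInd s' p := by
      intro s s' hs hs' h1 h2
      have e1 : s ≠ p := fun h => hs (h ▸ hp)
      rw [Ne, Prod.ext_iff] at e1
      rw [hUG.right s s' hs hs' h1 h2, leftInd_congr (s := s) (s' := s') (v := p) (v' := p)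
        (by omega)]
    have hv : ∀ s s', s ∉ A → s' ∉ A → s'.2 = s.2 + 1 → (s'.1 = s.1 ∨ s'.1 = s.1 - 1) →
        p.2 ≤ s.2 → s'.2 ≤ q.2 → G s + leftInd s p = G s' + leftInd s' p := by
      intro s s' hs hs' h1 h2 h3 h4
      have e1 := hUG.add_eq s hs
      rw [hUG.up s s' hs hs' h1 h2, leftInd_eq_zero (s := s) (v := q) (by omega)] at e1
      rw [leftInd_eq_zero (s := s') (v := p) (by omega)]
      have e : G s + G s = 0 := CharTwo.add_self_eq_zero _
      linear_combination e - e1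
    intro s s' hss hs hs' h1 h2 h3 h4
    rw [_root_.adj_iff] at hss
    rcases hss with h | h | h | h | h | h
    · exact hz s s' hs hs' (by omega) (by omega)
    · exact (hz s' s hs' hs (by omega) (by omega)).symm
    · exact hv s s' hs hs' (by omega) (by omega) (by omega) (by omega)
    · exact (hv s' s hs' hs (by omega) (by omega) (by omega) (by omega)).symm
    · exact (hv s' s hs' hs (by omega) (by omega) (by omega) (by omega)).symm
    · exact hv s s' hs hs' (by omega) (by omega) (by omega) (by omega)
  have htop : ∀ s, s ∉ A → s.2 = q.2 → (G s + leftInd s p = 1 ↔ q.1 < s.1) := by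
    intro s hs h1
    have e1 := hUG.add_eq s hs
    rw [hUG.up_zero s fun v hv => h1 ▸ (hA v hv).2] at e1
    have e : leftInd s p + leftInd s p = 0 := CharTwo.add_self_eq_zero _
    have e2 : G s + leftInd s p = leftInd s q := by linear_combination e1 + e
    rw [e2, leftInd]
    simp [h1]
  refine ⟨{s | G s + leftInd s p = 1}, ⟨?_, ?_, htop, ?_, ?_⟩⟩
  · intro s s' hss hs hs' h1 h2 h3 h4
    simp only [Set.mem_ofPred_eq, hadj s s' hss hs hs' h1 h2 h3 h4]
  · intro s hs h1
    simp only [Set.mem_ofPred_eq]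
    rw [hUG.down_zero s fun v hv => h1 ▸ (hA v hv).1, leftInd]
    simp [h1]
  · intro s hs h1
    simp only [Set.mem_ofPred_eq]
    rw [hUG.left_zero s h1, leftInd_eq_zero (by have := h1 p hp; omega)]
    simp
  · intro s hs h1 h2 h3
    obtain ⟨d, hd⟩ : ∃ d : ℕ, s.2 + d = q.2 := ⟨(q.2 - s.2).toNat, by omega⟩
    simp only [Set.mem_ofPred_eq]
    have hout : ∀ t, (s.1 + 1, t) ∉ A := fun t ht => by have := h3 _ ht; simp at this
    rw [hadj s (s.1 + 1, s.2) (by rw [_root_.adj_iff]; simp) hs (hout _) h1 h1 h2 h2]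
    have key : ∀ d : ℕ, ∀ t, p.2 ≤ t → t + d = q.2 →
        G (s.1 + 1, t) + leftInd (s.1 + 1, t) p = 1 := by
      intro d
      induction d with
      | zero =>
        intro t _ ht
        rw [htop _ (hout t) (by simpa using ht)]
        have := h3 q hq
        simp only
        omega
      | succ d ih =>
        intro t h4 h5
        push_cast at h5
        rw [hadj _ (s.1 + 1, t + 1) (by rw [_root_.adj_iff]; simp) (hout _) (hout _) h4
          (by simp only; omega) (by simp only; omega) (by simp only; omega)]
        exact ih (t + 1) (by omega) (by omega)
    exact key d s.2 h1 hd

/-- The side of a walk avoiding the crossing walk is constant. -/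
theorem IsRightSide.mem_iff_of_conn {A B S : Set Site} {p q a b : Site} (h : IsRightSide A p q S)
    (hab : Conn B a b) (hB : ∀ v ∈ B, v ∉ A ∧ p.2 ≤ v.2 ∧ v.2 ≤ q.2) : a ∈ S ↔ b ∈ S := by
  refine hab.rec_on (P := fun b => a ∈ S ↔ b ∈ S) Iff.rfl ?_
  intro u v hu huv hv ih
  have h1 := hB u hu.right_mem
  have h2 := hB v hv
  exact ih.trans (h.adj_iff u v huv h1.1 h2.1 h1.2.1 h2.2.1 h1.2.2 h2.2.2)

/-- A left-right walk and a bottom-top walk in a rectangle meet. -/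
theorem not_disjoint_crossings {A B : Set Site} {x0 x1 y0 y1 : ℤ} {p q a b : Site}
    (hA : Conn A p q) (hB : Conn B a b) (hAR : A ⊆ rect x0 x1 y0 y1) (hBR : B ⊆ rect x0 x1 y0 y1)
    (hp : p.2 = y0) (hq : q.2 = y1) (ha : a.1 = x0) (hb : b.1 = x1) : ¬ Disjoint A B := by
  intro hd
  obtain ⟨S, hS⟩ := exists_isRightSide hA fun v hv => by
    have := hAR hv
    simp only [rect, Set.mem_ofPred_eq] at this
    omega
  have hBA : ∀ v ∈ B, v ∉ A ∧ p.2 ≤ v.2 ∧ v.2 ≤ q.2 := fun v hv => by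
    have := hBR hv
    simp only [rect, Set.mem_ofPred_eq] at this
    exact ⟨fun h => Set.disjoint_left.1 hd h hv, by omega, by omega⟩
  have h1 := hBA a hB.left_mem
  have h2 := hBA b hB.right_mem
  refine hS.left a h1.1 (fun v hv => ha ▸ (hAR hv).1) ?_
  rw [hS.mem_iff_of_conn hB hBA]
  exact hS.right b h2.1 h2.2.1 h2.2.2 fun v hv => hb ▸ (hAR hv).2.1

/-- Indicator that an edge carries the labels `0` and `1`. -/
def edgeInd (a b : Fin 3) : ZMod 2 := if (a = 0 ∧ b = 1) ∨ (a = 1 ∧ b = 0) then 1 else 0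

theorem edgeInd_triangle (a b c : Fin 3) (h1 : ¬ (a = 0 ∧ b = 1 ∧ c = 2))
    (h2 : ¬ (a = 0 ∧ b = 2 ∧ c = 1)) (h3 : ¬ (a = 1 ∧ b = 0 ∧ c = 2))
      (h4 : ¬ (a = 1 ∧ b = 2 ∧ c = 0))
    (h5 : ¬ (a = 2 ∧ b = 0 ∧ c = 1)) (h6 : ¬ (a = 2 ∧ b = 1 ∧ c = 0)) :
    edgeInd a b + edgeInd b c = edgeInd a c := by
  revert a b c
  decide

/-- Sperner's lemma on a rectangular grid: a labelling by `0, 1, 2` whose left column is `0`, whose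
bottom row is `1`, and whose right column and top row are `2` has a trichromatic triangle. -/
theorem exists_trichromatic (lab : Site → Fin 3) (x y : ℤ) (k l : ℕ)
    (hleft : ∀ t, lab (x, t) = 0) (hbot : ∀ s, x < s → lab (s, y) = 1)
    (htop : ∀ s, x < s → lab (s, y + l) = 2)
    (hright : ∀ t, y ≤ t → lab (x + (k + 1), t) ≠ 0) :
    ∃ u v w, Adj u w ∧ Adj v w ∧ lab u = 0 ∧ lab v = 1 ∧ lab w = 2 := by
  by_contra! hno
  have hno' : ∀ u v w, Adj u w → Adj v w → ¬ (lab u = 0 ∧ lab v = 1 ∧ lab w = 2) :=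
    fun u v w h1 h2 h3 => hno u v w h1 h2 h3.1 h3.2.1 h3.2.2
  have tri : ∀ u v w, Adj u v → Adj v w → Adj u w →
      edgeInd (lab u) (lab v) + edgeInd (lab v) (lab w) = edgeInd (lab u) (lab w) := by
    intro u v w h1 h2 h3
    apply edgeInd_triangle
    · have := hno' u v w h3 h2; tauto
    · have := hno' u w v h1 h2.symm; tauto
    · have := hno' v u w h2 h3; tauto
    · have := hno' w u v h2.symm h1; tauto
    · have := hno' v w u h1.symm h3.symm; tauto
    · have := hno' w v u h3.symm h1.symm; tauto
  let H : ℤ → ℕ → ZMod 2 := fun t k =>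
    ∑ i ∈ Finset.range k, edgeInd (lab (x + i, t)) (lab (x + (i + 1), t))
  have hH : ∀ t k, H t k + H (t + 1) k =
      edgeInd (lab (x, t)) (lab (x, t + 1)) + edgeInd (lab (x + k, t)) (lab (x + k, t + 1)) := by
    intro t k
    induction k with
    | zero => simp [H, CharTwo.add_self_eq_zero]
    | succ k ih =>
      simp only [H, Finset.sum_range_succ] at ih ⊢
      have e1 := tri (x + k, t) (x + (k + 1), t) (x + k, t + 1) (by simp [adj_iff]; omega)
        (by simp [adj_iff]; omega) (by simp [adj_iff])
      have e2 := tri (x + (k + 1), t) (x + k, t + 1) (x + (k + 1), t + 1) (by simp [adj_iff]; omega)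
        (by simp [adj_iff]; omega) (by simp [adj_iff])
      push_cast
      have e3 : edgeInd (lab (x + k, t)) (lab (x + k, t + 1)) +
        edgeInd (lab (x + k, t)) (lab (x + k, t + 1)) = 0 := CharTwo.add_self_eq_zero _
      have e4 : edgeInd (lab (x + (k + 1), t)) (lab (x + k, t + 1)) +
        edgeInd (lab (x + (k + 1), t)) (lab (x + k, t + 1)) = 0 := CharTwo.add_self_eq_zero _
      linear_combination ih + e1 + e2 + e3 - e4
  have hconst : ∀ j : ℕ, H (y + j) (k + 1) = H y (k + 1) := by
    intro j
    induction j with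
    | zero => simp
    | succ j ih =>
      have e := hH (y + j) (k + 1)
      rw [hleft, hleft] at e
      have h0 : edgeInd (lab (x + ((k + 1 : ℕ) : ℤ), y + j))
        (lab (x + ((k + 1 : ℕ) : ℤ), y + j + 1)) = 0 := by
        have h1 := hright (y + j) (by omega)
        have h2 := hright (y + j + 1) (by omega)
        push_cast
        simp [edgeInd, h1, h2]
      have h00 : edgeInd 0 0 = 0 := by decide
      rw [h0, h00, ih] at e
      have e' : H y (k + 1) + H y (k + 1) = 0 := CharTwo.add_self_eq_zero _
      push_cast
      rw [← add_assoc]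
      linear_combination e - e'
  have h1 : ∀ t c, (∀ s, x < s → lab (s, t) = c) → c ≠ 0 → H t (k + 1) = edgeInd 0 c := by
    intro t c hc hc0
    simp only [H, Finset.sum_range_succ']
    rw [Finset.sum_eq_zero]
    · simp [hleft, hc]
    · intro i _
      rw [hc _ (by push_cast; omega), hc _ (by push_cast; omega)]
      simp [edgeInd, hc0]
  have := hconst l
  rw [h1 _ 2 htop (by decide), h1 _ 1 hbot (by decide)] at this
  revert this
  decide

/-- In a rectangle, either `P` contains a left-right walk or its complement a bottom-top walk. -/
theorem crossing_or_crossing {x0 x1 y0 y1 : ℤ} (hx : x0 ≤ x1) (hy : y0 ≤ y1) (P : Set Site) :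
    (∃ a b, a.1 = x0 ∧ b.1 = x1 ∧ Conn {v | v ∈ rect x0 x1 y0 y1 ∧ v ∈ P} a b) ∨
    (∃ a b, a.2 = y0 ∧ b.2 = y1 ∧ Conn {v | v ∈ rect x0 x1 y0 y1 ∧ v ∉ P} a b) := by
  classical
  by_contra! hno
  obtain ⟨hno1, hno2⟩ := hno
  let c1 : Site → Prop := fun v => ∃ a, a.1 = x0 ∧ Conn {v | v ∈ rect x0 x1 y0 y1 ∧ v ∈ P} a v
  let c2 : Site → Prop := fun v => ∃ a, a.2 = y0 ∧ Conn {v | v ∈ rect x0 x1 y0 y1 ∧ v ∉ P} a v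
  let lab : Site → Fin 3 := fun v => if v.1 < x0 then 0 else if v.2 < y0 then 1 else
    if x1 < v.1 ∨ y1 < v.2 then 2 else if c1 v then 0 else if c2 v then 1 else 2
  have lab0 : ∀ v, lab v = 0 → v.1 < x0 ∨ c1 v := by
    intro v hv
    simp only [lab] at hv
    split_ifs at hv <;> simp_all
  have lab1 : ∀ v, lab v = 1 → v.2 < y0 ∨ c2 v := by
    intro v hv
    simp only [lab] at hv
    split_ifs at hv <;> simp_all
  have lab2 : ∀ v, lab v = 2 → x0 ≤ v.1 ∧ y0 ≤ v.2 ∧ (x1 < v.1 ∨ y1 < v.2 ∨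
      v.1 ≤ x1 ∧ v.2 ≤ y1 ∧ ¬ c1 v ∧ ¬ c2 v) := by
    intro v hv
    simp only [lab] at hv
    split_ifs at hv with g1 g2 g3 g4 g5
    · exact absurd hv (by decide)
    · exact absurd hv (by decide)
    · exact ⟨by omega, by omega, by tauto⟩
    · exact absurd hv (by decide)
    · exact absurd hv (by decide)
    · exact ⟨by omega, by omega, .inr (.inr ⟨by omega, by omega, g4, g5⟩)⟩
  obtain ⟨k, hk⟩ : ∃ k : ℕ, x0 + k = x1 + 1 := ⟨(x1 + 1 - x0).toNat, by omega⟩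
  obtain ⟨l, hl⟩ : ∃ l : ℕ, y0 - 1 + l = y1 + 1 := ⟨(y1 + 1 - (y0 - 1)).toNat, by omega⟩
  obtain ⟨u, v, w, huw, hvw, hu, hv, hw⟩ := exists_trichromatic lab (x0 - 1) (y0 - 1) k l
    (fun t => by simp [lab]) (fun s hs => by simp [lab]; omega)
    (fun s hs => by
      have e1 : ¬ s < x0 := by omega
      have e2 : ¬ y1 + 1 < y0 := by omega
      simp [lab, hl, e1, e2])
    (fun t ht => by
      have e : x0 - 1 + ((k : ℤ) + 1) = x1 + 1 := by omega
      have e1 : ¬ x1 + 1 < x0 := by omega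
      rw [e]
      simp only [lab, e1, if_false]
      split_ifs <;> first | decide | (exfalso; simp_all))
  have hw2 := lab2 w hw
  rw [adj_iff] at huw hvw
  have mem1 : ∀ {v}, c1 v → v ∈ rect x0 x1 y0 y1 := fun ⟨_, _, h⟩ => h.right_mem.1
  have mem2 : ∀ {v}, c2 v → v ∈ rect x0 x1 y0 y1 := fun ⟨_, _, h⟩ => h.right_mem.1
  rcases hw2 with ⟨h1, h2, h3 | h3 | ⟨h3, h4, h5, h6⟩⟩
  · rcases lab0 u hu with h | h
    · omega
    · have hm := mem1 h
      obtain ⟨a, ha, hc⟩ := h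
      simp only [rect, Set.mem_ofPred_eq] at hm
      exact hno1 a u ha (by omega) hc
  · rcases lab1 v hv with h | h
    · omega
    · have hm := mem2 h
      obtain ⟨a, ha, hc⟩ := h
      simp only [rect, Set.mem_ofPred_eq] at hm
      exact hno2 a v ha (by omega) hc
  · have hwr : w ∈ rect x0 x1 y0 y1 := ⟨h1, h3, h2, h4⟩
    by_cases hwP : w ∈ P
    · apply h5
      rcases lab0 u hu with h | ⟨a, ha, hc⟩
      · exact ⟨w, by omega, .refl ⟨hwr, hwP⟩⟩
      · exact ⟨a, ha, hc.step (by rw [adj_iff]; exact huw) ⟨hwr, hwP⟩⟩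
    · apply h6
      rcases lab1 v hv with h | ⟨a, ha, hc⟩
      · exact ⟨w, by omega, .refl ⟨hwr, hwP⟩⟩
      · exact ⟨a, ha, hc.step (by rw [adj_iff]; exact hvw) ⟨hwr, hwP⟩⟩

/-- The event `E` is determined by the states of the sites in `S`. -/
def Dep (S : Set Site) (E : Set Config) : Prop :=
  ∀ ω ω' : Config, (∀ v ∈ S, ω v = ω' v) → ω ∈ E → ω' ∈ E

namespace Dep

variable {S T : Set Site} {E F : Set Config}

theorem mono (h : Dep S E) (hST : S ⊆ T) : Dep T E :=
  fun ω ω' h1 h2 => h ω ω' (fun v hv => h1 v (hST hv)) h2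

theorem compl (h : Dep S E) : Dep S Eᶜ :=
  fun ω ω' h1 h2 h3 => h2 (h ω' ω (fun v hv => (h1 v hv).symm) h3)

theorem inter (h : Dep S E) (h' : Dep S F) : Dep S (E ∩ F) :=
  fun ω ω' h1 h2 => ⟨h ω ω' h1 h2.1, h' ω ω' h1 h2.2⟩

end Dep

/-- The configuration whose open sites are those of `T`. -/
def confOf (S : Finset Site) (T : Finset S) : Config := fun v => decide (∃ h : v ∈ S, ⟨v, h⟩ ∈ T)

/-- The configurations agreeing with `confOf S T` on `S`. -/
def cyl (S : Finset Site) (T : Finset S) : Set Config := {ω | ∀ v ∈ S, ω v = confOf S T v}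

open Classical in
/-- The open subsets of `S` realizing the event `E`. -/
noncomputable def traces (S : Finset Site) (E : Set Config) : Finset (Finset S) :=
  Finset.univ.filter fun T => confOf S T ∈ E

theorem mem_traces {S : Finset Site} {E : Set Config} {T : Finset S} :
    T ∈ traces S E ↔ confOf S T ∈ E := by simp [traces]

theorem confOf_apply {S : Finset Site} {T : Finset S} (v : S) :
    confOf S T v = true ↔ v ∈ T := by
  simp [confOf]

theorem measurableSet_cyl (S : Finset Site) (T : Finset S) : MeasurableSet (cyl S T) := by
  have : cyl S T = ⋂ v ∈ S, {ω | ω v = confOf S T v} := by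
    ext ω
    simp [cyl]
  rw [this]
  refine Finset.measurableSet_biInter S fun v _ => ?_
  exact measurableSet_eq_fun (measurable_pi_apply v) measurable_const

theorem cyl_disjoint {S : Finset Site} {T T' : Finset S} (h : T ≠ T') :
    Disjoint (cyl S T) (cyl S T') := by
  rw [Set.disjoint_left]
  intro ω h1 h2
  apply h
  ext v
  rw [← confOf_apply, ← confOf_apply, ← h1 v v.2, ← h2 v v.2]

theorem Dep.eq_biUnion {S : Finset Site} {E : Set Config} (h : Dep S E) :
    E = ⋃ T ∈ traces S E, cyl S T := by
  classical
  ext ω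
  simp only [Set.mem_iUnion, mem_traces, exists_prop]
  constructor
  · intro hω
    have hc : ∀ v ∈ (S : Set Site),
        ω v = confOf S (Finset.univ.filter fun v : S => ω v = true) v := by
      intro v hv
      rw [Bool.eq_iff_iff, confOf_apply (⟨v, hv⟩ : S)]
      simp
    exact ⟨_, h ω _ hc hω, hc⟩
  · rintro ⟨T, h1, h2⟩
    exact h _ _ (fun v hv => (h2 v hv).symm) h1

theorem Dep.measurableSet {S : Set Site} {E : Set Config} (h : Dep S E) (hS : S.Finite) :
    MeasurableSet E := by
  rw [← hS.coe_toFinset] at h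
  rw [h.eq_biUnion]
  exact Finset.measurableSet_biUnion _ fun T _ => measurableSet_cyl _ T

section

variable {μ : Measure Config} (hμ : IsBernoulliHalf μ)
include hμ

theorem prob_inter_eq_sum {S : Finset Site} {E G : Set Config} (h : Dep S E)
    (hG : MeasurableSet G) : μ.real (E ∩ G) = ∑ T ∈ traces S E, μ.real (cyl S T ∩ G) := by
  have := hμ.1
  conv_lhs => rw [h.eq_biUnion, Set.iUnion₂_inter]
  rw [measureReal_biUnion_finset]
  · intro T _ T' _ hT
    exact (cyl_disjoint hT).mono Set.inter_subset_left Set.inter_subset_left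
  · intro T _
    exact (measurableSet_cyl S T).inter hG

theorem prob_cyl (S : Finset Site) (T : Finset S) : μ.real (cyl S T) = (1 / 2) ^ S.card := by
  rw [measureReal_def, cyl, hμ.2 S (confOf S T)]
  simp

theorem prob_eq_card {S : Finset Site} {E : Set Config} (h : Dep S E) :
    μ.real E = (traces S E).card * (1 / 2) ^ S.card := by
  have := prob_inter_eq_sum hμ h MeasurableSet.univ
  simp only [Set.inter_univ, prob_cyl hμ, Finset.sum_const, nsmul_eq_mul] at this
  exact this

theorem prob_inter_of_disjoint_finset {S T : Finset Site} {E F : Set Config} (hE : Dep S E)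
    (hF : Dep T F)
    (hST : Disjoint S T) : μ.real (E ∩ F) = μ.real E * μ.real F := by
  classical
  have key : ∀ A B, μ.real (cyl T B ∩ cyl S A) = (1 / 2) ^ S.card * (1 / 2) ^ T.card := by
    intro A B
    have e : cyl T B ∩ cyl S A =
        {ω | ∀ v ∈ S ∪ T, ω v = if v ∈ S then confOf S A v else confOf T B v} := by
      ext ω
      constructor
      · rintro ⟨h1, h2⟩ v hv
        by_cases h : v ∈ S
        · simp [h, h2 v h]
        · simp only [h, if_false]
          exact h1 v ((Finset.mem_union.1 hv).resolve_left h)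
      · intro h1
        refine ⟨fun v hv => ?_, fun v hv => ?_⟩
        · have := h1 v (Finset.mem_union_right _ hv)
          rwa [if_neg (Finset.disjoint_right.1 hST hv)] at this
        · have := h1 v (Finset.mem_union_left _ hv)
          rwa [if_pos hv] at this
    rw [e, measureReal_def, hμ.2, Finset.card_union_of_disjoint hST]
    simp [pow_add]
  rw [prob_inter_eq_sum hμ hE (hF.measurableSet T.finite_toSet), prob_eq_card hμ hE,
      prob_eq_card hμ hF]
  have : ∀ A, μ.real (cyl S A ∩ F) = (traces T F).card * ((1 / 2) ^ S.card * (1 / 2) ^ T.card) := by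
    intro A
    rw [Set.inter_comm, prob_inter_eq_sum hμ hF (measurableSet_cyl S A)]
    simp only [key, Finset.sum_const, nsmul_eq_mul]
  simp only [this, Finset.sum_const, nsmul_eq_mul]
  ring

/-- Events depending on disjoint finite sets of sites are independent. -/
theorem prob_inter_of_disjoint {S T : Set Site} {E F : Set Config} (hE : Dep S E) (hF : Dep T F)
    (hS : S.Finite) (hT : T.Finite) (hST : Disjoint S T) :
    μ.real (E ∩ F) = μ.real E * μ.real F := by
  refine prob_inter_of_disjoint_finset hμ (S := hS.toFinset) (T := hT.toFinset) ?_ ?_ ?_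
  · rwa [hS.coe_toFinset]
  · rwa [hT.coe_toFinset]
  · rw [← Finset.disjoint_coe, hS.coe_toFinset, hT.coe_toFinset]
    exact hST

theorem prob_nonneg_le_one (E : Set Config) : 0 ≤ μ.real E ∧ μ.real E ≤ 1 :=
  have := hμ.1
  ⟨measureReal_nonneg, measureReal_le_one⟩

theorem prob_compl {S : Set Site} {E : Set Config} (hE : Dep S E) (hS : S.Finite) :
    μ.real Eᶜ = 1 - μ.real E := by
  have := hμ.1
  rw [measureReal_compl (hE.measurableSet hS), probReal_univ]

theorem prob_mono {E F : Set Config} (h : E ⊆ F) : μ.real E ≤ μ.real F :=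
  have := hμ.1
  measureReal_mono h

/-- Harris' inequality. -/
theorem harris {S : Set Site} {E F : Set Config} (hS : S.Finite) (hE : Dep S E) (hF : Dep S F)
    (h : IsUpperSet E ∧ IsUpperSet F ∨ IsLowerSet E ∧ IsLowerSet F) :
    μ.real E * μ.real F ≤ μ.real (E ∩ F) := by
  classical
  rw [← hS.coe_toFinset] at hE hF
  set S' := hS.toFinset
  have hle : ∀ {T T' : Finset S'}, T ⊆ T' → confOf S' T ≤ confOf S' T' := by
    intro T T' h v
    simp only [confOf]
    refine Bool.le_iff_imp.2 ?_
    simp only [decide_eq_true_eq]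
    rintro ⟨h1, h2⟩
    exact ⟨h1, h h2⟩
  have hi : traces S' (E ∩ F) = traces S' E ∩ traces S' F := by
    ext T
    simp [mem_traces]
  have key : (traces S' E).card * (traces S' F).card ≤
      2 ^ S'.card * (traces S' (E ∩ F)).card := by
    rw [hi, ← Fintype.card_coe S']
    rcases h with ⟨h1, h2⟩ | ⟨h1, h2⟩
    · refine IsUpperSet.le_card_inter_finset ?_ ?_ <;> intro T T' hT hm <;>
        simp only [Finset.mem_coe, mem_traces] at hm ⊢
      · exact h1 (hle hT) hm
      · exact h2 (hle hT) hm
    · refine IsLowerSet.le_card_inter_finset ?_ ?_ <;> intro T T' hT hm <;>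
        simp only [Finset.mem_coe, mem_traces] at hm ⊢
      · exact h1 (hle hT) hm
      · exact h2 (hle hT) hm
  rw [prob_eq_card hμ hE, prob_eq_card hμ hF, prob_eq_card hμ (hE.inter hF)]
  have key' : ((traces S' E).card : ℝ) * (traces S' F).card ≤
      2 ^ S'.card * (traces S' (E ∩ F)).card := by exact_mod_cast key
  have hp : (2 : ℝ) ^ S'.card * (1 / 2) ^ S'.card = 1 := by
    rw [← mul_pow]
    norm_num
  have hn : (0 : ℝ) ≤ (1 / 2) ^ S'.card * (1 / 2) ^ S'.card := by positivity
  calc _ = ((traces S' E).card : ℝ) * (traces S' F).card *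
      ((1 / 2) ^ S'.card * (1 / 2) ^ S'.card) := by ring
    _ ≤ (2 ^ S'.card * (traces S' (E ∩ F)).card) * ((1 / 2) ^ S'.card * (1 / 2) ^ S'.card) :=
        mul_le_mul_of_nonneg_right key' hn
    _ = _ := by linear_combination ((traces S' (E ∩ F)).card : ℝ) * (1 / 2) ^ S'.card * hp

theorem isBernoulliHalf_map (b : Bool) (τ : Site ≃ Site) :
    IsBernoulliHalf (μ.map fun ω v => xor b (ω (τ v))) := by
  classical
  have hm : Measurable fun (ω : Config) (v : Site) => xor b (ω (τ v)) := by
    rw [measurable_pi_iff]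
    intro v
    exact (measurable_of_countable (xor b)).comp (measurable_pi_apply (τ v))
  have := hμ.1
  refine ⟨Measure.isProbabilityMeasure_map hm.aemeasurable, fun S f => ?_⟩
  have hms : MeasurableSet {ω : Config | ∀ v ∈ S, ω v = f v} :=
    Dep.measurableSet (S := S) (fun ω ω' h1 h2 v hv => (h1 v hv).symm.trans (h2 v hv))
      S.finite_toSet
  rw [Measure.map_apply hm hms]
  have := hμ.2 (S.map τ.toEmbedding) (fun v => xor b (f (τ.symm v)))
  rw [Finset.card_map] at this
  rw [← this]
  congr 1
  ext ω
  simp only [Set.mem_preimage, Set.mem_ofPred_eq, Finset.mem_map, Equiv.coe_toEmbedding,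
    forall_exists_index, and_imp, forall_apply_eq_imp_iff₂, Equiv.symm_apply_apply]
  refine forall₂_congr fun v _ => ?_
  cases b <;> cases ω (τ v) <;> cases f v <;> simp

/-- Invariance of the measure under permutations of the sites and colour flips. -/
theorem prob_congr {S : Set Site} {E E' : Set Config} (hS : S.Finite) (hE : Dep S E) (b : Bool)
    (τ : Site ≃ Site) (h : ∀ ω : Config, ω ∈ E' ↔ (fun v => xor b (ω (τ v))) ∈ E) :
    μ.real E' = μ.real E := by
  have hm : Measurable fun (ω : Config) (v : Site) => xor b (ω (τ v)) := by
    rw [measurable_pi_iff]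
    intro v
    exact (measurable_of_countable (xor b)).comp (measurable_pi_apply (τ v))
  have e : E' = (fun (ω : Config) (v : Site) => xor b (ω (τ v))) ⁻¹' E := by
    ext ω
    exact h ω
  rw [e, ← map_measureReal_apply hm (hE.measurableSet hS)]
  rw [← hS.coe_toFinset] at hE
  rw [prob_eq_card (isBernoulliHalf_map hμ b τ) hE, prob_eq_card hμ hE]

/-- Comparison of two events attached to an exploration, given its outcome. -/
theorem prob_explore_le {ι : Type*} {K : Config → ι} {I : Finset ι} (hK : ∀ ω, K ω ∈ I)
    (G : Set ι) (S T : ι → Set Site) (C C' : ι → Set Config) (a : ℝ)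
    (hS : ∀ k ∈ G, (S k).Finite) (hT : ∀ k ∈ G, (T k).Finite)
    (hST : ∀ k ∈ G, Disjoint (S k) (T k)) (hdep : ∀ k ∈ G, Dep (S k) {ω | K ω = k})
    (hC : ∀ k ∈ G, Dep (T k) (C k)) (hC' : ∀ k ∈ G, Dep (T k) (C' k))
    (h : ∀ k ∈ G, μ.real (C k) ≤ a * μ.real (C' k)) :
    μ.real {ω | K ω ∈ G ∧ ω ∈ C (K ω)} ≤ a * μ.real {ω | K ω ∈ G ∧ ω ∈ C' (K ω)} := by
  classical
  have := hμ.1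
  have key : ∀ C : ι → Set Config, (∀ k ∈ G, Dep (T k) (C k)) →
      μ.real {ω | K ω ∈ G ∧ ω ∈ C (K ω)} =
        ∑ k ∈ I.filter (· ∈ G), μ.real {ω | K ω = k} * μ.real (C k) := by
    intro C hC
    have e : {ω | K ω ∈ G ∧ ω ∈ C (K ω)} = ⋃ k ∈ I.filter (· ∈ G), ({ω | K ω = k} ∩ C k) := by
      ext ω
      simp only [Set.mem_ofPred_eq, Set.mem_iUnion, Finset.mem_filter, Set.mem_inter_iff,
        exists_prop]
      constructor
      · rintro ⟨h1, h2⟩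
        exact ⟨_, ⟨hK ω, h1⟩, rfl, h2⟩
      · rintro ⟨k, ⟨_, h1⟩, rfl, h2⟩
        exact ⟨h1, h2⟩
    rw [e, measureReal_biUnion_finset]
    · refine Finset.sum_congr rfl fun k hk => ?_
      have hk := (Finset.mem_filter.1 hk).2
      exact prob_inter_of_disjoint hμ (hdep k hk) (hC k hk) (hS k hk) (hT k hk) (hST k hk)
    · intro k _ k' _ hkk
      rw [Function.onFun, Set.disjoint_left]
      rintro ω ⟨h1, _⟩ ⟨h2, _⟩
      exact hkk (h1.symm.trans h2)
    · intro k hk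
      have hk := (Finset.mem_filter.1 hk).2
      exact ((hdep k hk).measurableSet (hS k hk)).inter ((hC k hk).measurableSet (hT k hk))
  rw [key C hC, key C' hC', Finset.mul_sum]
  refine Finset.sum_le_sum fun k hk => ?_
  have hk := (Finset.mem_filter.1 hk).2
  have h0 : 0 ≤ μ.real {ω | K ω = k} := measureReal_nonneg
  nlinarith [h k hk]

end

/-- A walk of colour `c` inside `R` joins `X` to `Y`. -/
def Cross (c : Bool) (R X Y : Set Site) : Set Config :=
  {ω | ∃ a ∈ X, ∃ b ∈ Y, Conn {v | v ∈ R ∧ ω v = c} a b}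

theorem dep_cross (c : Bool) (R X Y : Set Site) : Dep R (Cross c R X Y) := by
  rintro ω ω' h ⟨a, ha, b, hb, hab⟩
  exact ⟨a, ha, b, hb, hab.mono fun v hv => ⟨hv.1, h v hv.1 ▸ hv.2⟩⟩

theorem cross_mono {c : Bool} {R X Y R' X' Y' : Set Site} (hR : R ⊆ R') (hX : X ⊆ X')
    (hY : Y ⊆ Y') :
    Cross c R X Y ⊆ Cross c R' X' Y' := by
  rintro ω ⟨a, ha, b, hb, hab⟩
  exact ⟨a, hX ha, b, hY hb, hab.mono fun v hv => ⟨hR hv.1, hv.2⟩⟩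

theorem cross_symm {c : Bool} {R X Y : Set Site} {ω : Config} (h : ω ∈ Cross c R X Y) :
    ω ∈ Cross c R Y X := by
  obtain ⟨a, ha, b, hb, hab⟩ := h
  exact ⟨b, hb, a, ha, hab.symm⟩

theorem isLowerSet_cross (R X Y : Set Site) : IsLowerSet (Cross false R X Y) := by
  rintro ω ω' h ⟨a, ha, b, hb, hab⟩
  refine ⟨a, ha, b, hb, hab.mono fun v hv => ⟨hv.1, ?_⟩⟩
  have h1 := Bool.le_iff_imp.1 (h v)
  have h2 := hv.2
  revert h1 h2
  cases ω v <;> cases ω' v <;> simp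

/-- Left-right crossing of a rectangle in colour `c`. -/
def HC (c : Bool) (x0 x1 y0 y1 : ℤ) : Set Config :=
  Cross c (rect x0 x1 y0 y1) {v | v.1 = x0} {v | v.1 = x1}

/-- Bottom-top crossing of a rectangle in colour `c`. -/
def VC (c : Bool) (x0 x1 y0 y1 : ℤ) : Set Config :=
  Cross c (rect x0 x1 y0 y1) {v | v.2 = y0} {v | v.2 = y1}

theorem dep_HC (c : Bool) (x0 x1 y0 y1 : ℤ) : Dep (rect x0 x1 y0 y1) (HC c x0 x1 y0 y1) :=
  dep_cross _ _ _ _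

theorem dep_VC (c : Bool) (x0 x1 y0 y1 : ℤ) : Dep (rect x0 x1 y0 y1) (VC c x0 x1 y0 y1) :=
  dep_cross _ _ _ _

theorem finite_rect (x0 x1 y0 y1 : ℤ) : (rect x0 x1 y0 y1).Finite := by
  refine ((Set.finite_Icc x0 x1).prod (Set.finite_Icc y0 y1)).subset ?_
  rintro v ⟨h1, h2, h3, h4⟩
  exact ⟨⟨h1, h2⟩, ⟨h3, h4⟩⟩

theorem HC_or_VC {x0 x1 y0 y1 : ℤ} (hx : x0 ≤ x1) (hy : y0 ≤ y1) (c : Bool) (ω : Config) :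
    ω ∈ HC c x0 x1 y0 y1 ∨ ω ∈ VC (!c) x0 x1 y0 y1 := by
  rcases crossing_or_crossing hx hy {v | ω v = c} with ⟨a, b, h1, h2, h3⟩ | ⟨a, b, h1, h2, h3⟩
  · exact .inl ⟨a, h1, b, h2, h3⟩
  · refine .inr ⟨a, h1, b, h2, h3.mono fun v hv => ⟨hv.1, ?_⟩⟩
    have := hv.2
    simp only [Set.mem_ofPred_eq] at this
    revert this
    cases ω v <;> cases c <;> simp

theorem not_HC_and_VC {x0 x1 y0 y1 : ℤ} {c : Bool} {ω : Config}
    (h1 : ω ∈ HC c x0 x1 y0 y1) (h2 : ω ∈ VC (!c) x0 x1 y0 y1) : False := by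
  obtain ⟨a, ha, b, hb, hab⟩ := h1
  obtain ⟨p, hp, q, hq, hpq⟩ := h2
  refine not_disjoint_crossings hpq hab (fun v hv => hv.1) (fun v hv => hv.1) hp hq ha hb ?_
  rw [Set.disjoint_left]
  rintro v ⟨_, h1⟩ ⟨_, h2⟩
  rw [h1] at h2
  cases c <;> simp at h2

theorem HC_eq_compl {x0 x1 y0 y1 : ℤ} (hx : x0 ≤ x1) (hy : y0 ≤ y1) (c : Bool) :
    HC c x0 x1 y0 y1 = (VC (!c) x0 x1 y0 y1)ᶜ := by
  ext ω
  exact ⟨fun h h' => not_HC_and_VC h h', fun h => (HC_or_VC hx hy c ω).resolve_right h⟩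

/-- Lattice automorphisms. -/
def IsAut (τ : Site ≃ Site) : Prop := ∀ u v, Adj (τ u) (τ v) ↔ Adj u v

theorem isAut_swap : IsAut (Equiv.prodComm ℤ ℤ) := by
  intro u v
  simp only [adj_iff, Equiv.prodComm_apply, Prod.fst_swap, Prod.snd_swap]
  omega

/-- Translation of the lattice. -/
def transl (a b : ℤ) : Site ≃ Site where
  toFun v := (v.1 + a, v.2 + b)
  invFun v := (v.1 - a, v.2 - b)
  left_inv v := by simp
  right_inv v := by simp

theorem isAut_transl (a b : ℤ) : IsAut (transl a b) := by
  intro u v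
  simp only [adj_iff, transl, Equiv.coe_fn_mk]
  omega

section

variable {μ : Measure Config} (hμ : IsBernoulliHalf μ)
include hμ

theorem prob_cross_map {τ : Site ≃ Site} (hτ : IsAut τ) (b c : Bool) {R : Set Site} (X Y : Set Site)
    (hR : R.Finite) :
    μ.real (Cross c (τ ⁻¹' R) (τ ⁻¹' X) (τ ⁻¹' Y)) = μ.real (Cross (xor b c) R X Y) := by
  refine prob_congr hμ hR (dep_cross _ _ _ _) b τ.symm fun ω => ?_
  constructor
  · rintro ⟨a, ha, d, hd, had⟩
    refine ⟨τ a, ha, τ d, hd, had.map (fun u v => (hτ u v).2) ?_⟩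
    rintro v ⟨h1, h2⟩
    exact ⟨h1, by simp [h2]⟩
  · rintro ⟨a, ha, d, hd, had⟩
    refine ⟨τ.symm a, by simpa using ha, τ.symm d, by simpa using hd, had.map (fun u v h => ?_) ?_⟩
    · rw [← hτ]
      simpa using h
    · rintro v ⟨h1, h2⟩
      refine ⟨by simpa using h1, ?_⟩
      have h3 : xor b (ω (τ.symm v)) = xor b c := h2
      simpa using h3

theorem prob_HC_map (c c' : Bool) (a b x0 x1 y0 y1 : ℤ) :
    μ.real (HC c x0 x1 y0 y1) = μ.real (HC c' (x0 + a) (x1 + a) (y0 + b) (y1 + b)) := by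
  have h := prob_cross_map hμ (isAut_transl a b) (xor c c') c {v | v.1 = x0 + a} {v | v.1 = x1 + a}
    (finite_rect (x0 + a) (x1 + a) (y0 + b) (y1 + b))
  have e : xor (xor c c') c = c' := by cases c <;> cases c' <;> rfl
  rw [e] at h
  rw [HC, HC, ← h]
  congr 2 <;> ext v <;> simp [transl, rect]

theorem prob_VC_swap (c : Bool) (x0 x1 y0 y1 : ℤ) :
    μ.real (VC c x0 x1 y0 y1) = μ.real (HC c y0 y1 x0 x1) := by
  have h := prob_cross_map hμ isAut_swap false c {v | v.1 = y0} {v | v.1 = y1}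
    (finite_rect y0 y1 x0 x1)
  rw [Bool.false_xor] at h
  rw [HC, VC, ← h]
  congr 2
  ext v
  simp [rect]
  tauto

end

/-- Probability of crossing a rectangle with `w + 1` columns and `h + 1` rows from left to right. -/
noncomputable def crossProb (μ : Measure Config) (w h : ℤ) : ℝ := μ.real (HC true 0 w 0 h)

section

variable {μ : Measure Config} (hμ : IsBernoulliHalf μ)
include hμ

theorem prob_HC (c : Bool) (x0 x1 y0 y1 : ℤ) :
    μ.real (HC c x0 x1 y0 y1) = crossProb μ (x1 - x0) (y1 - y0) := by
  rw [prob_HC_map hμ c true (-x0) (-y0), crossProb]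
  simp [sub_eq_add_neg]

theorem prob_VC (c : Bool) (x0 x1 y0 y1 : ℤ) :
    μ.real (VC c x0 x1 y0 y1) = crossProb μ (y1 - y0) (x1 - x0) := by
  rw [prob_VC_swap hμ, prob_HC hμ]

theorem crossProb_add {w h : ℤ} (hw : 0 ≤ w) (hh : 0 ≤ h) :
    crossProb μ w h + crossProb μ h w = 1 := by
  have h1 := prob_compl hμ (dep_VC false 0 w 0 h) (finite_rect _ _ _ _)
  have h2 := HC_eq_compl hw hh true
  rw [Bool.not_true] at h2
  rw [← h2, prob_HC hμ, prob_VC hμ] at h1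
  simp only [sub_zero] at h1
  linarith

theorem crossProb_self {w : ℤ} (hw : 0 ≤ w) : crossProb μ w w = 1 / 2 := by
  have := crossProb_add hμ hw hw
  linarith

theorem crossProb_mono_right {w h h' : ℤ} (hh : h ≤ h') : crossProb μ w h ≤ crossProb μ w h' := by
  refine prob_mono hμ (cross_mono ?_ subset_rfl subset_rfl)
  rintro v ⟨h1, h2, h3, h4⟩
  exact ⟨h1, h2, h3, h4.trans hh⟩

end

/-- The sites joined to `X` by a walk of colour `c` in `R`. -/
def cluster (c : Bool) (R X : Set Site) (ω : Config) : Set Site :=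
  {v | ∃ x ∈ X, Conn {u | u ∈ R ∧ ω u = c} x v}

/-- The sites revealed by an exploration of the cluster `k` of `X` in `R`. -/
def hull (R X k : Set Site) : Set Site := {v | v ∈ R ∧ (v ∈ k ∨ v ∈ X ∨ ∃ u ∈ k, Adj u v)}

theorem hull_subset (R X k : Set Site) : hull R X k ⊆ R := fun _ h => h.1

theorem mem_of_mem_cluster {c : Bool} {R X : Set Site} {ω : Config} {v : Site}
    (h : v ∈ cluster c R X ω) : v ∈ R ∧ ω v = c := by
  obtain ⟨x, _, hv⟩ := h
  exact hv.right_mem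

theorem cluster_subset_hull {c : Bool} {R X : Set Site} {ω : Config} :
    cluster c R X ω ⊆ hull R X (cluster c R X ω) :=
  fun _ h => ⟨(mem_of_mem_cluster h).1, .inl h⟩

theorem mem_cluster_of_mem_hull {c : Bool} {R X : Set Site} {ω : Config} {v : Site}
    (h : v ∈ hull R X (cluster c R X ω)) (hv : ω v = c) : v ∈ cluster c R X ω := by
  obtain ⟨hR, h | h | ⟨u, ⟨x, hx, hu⟩, huv⟩⟩ := h
  · exact h
  · exact ⟨v, h, .refl ⟨hR, hv⟩⟩
  · exact ⟨x, hx, hu.step huv ⟨hR, hv⟩⟩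

theorem conn_cluster {c : Bool} {R X : Set Site} {ω : Config} {v : Site}
    (h : v ∈ cluster c R X ω) : ∃ x ∈ X, Conn (cluster c R X ω) x v := by
  obtain ⟨x, hx, hv⟩ := h
  exact ⟨x, hx, hv.within.mono fun u hu => ⟨x, hx, hu⟩⟩

theorem dep_cluster_eq (c : Bool) (R X k : Set Site) :
    Dep (hull R X k) {ω | cluster c R X ω = k} := by
  rintro ω ω' h rfl
  refine Set.Subset.antisymm ?_ ?_
  · rintro v ⟨x, hx, hv⟩
    refine hv.rec_on (P := fun v => v ∈ cluster c R X ω) ?_ ?_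
    · have hm : x ∈ hull R X (cluster c R X ω) := ⟨hv.left_mem.1, .inr (.inl hx)⟩
      exact mem_cluster_of_mem_hull hm ((h x hm).trans hv.left_mem.2)
    · intro u w _ huw hw hu
      have hm : w ∈ hull R X (cluster c R X ω) := ⟨hw.1, .inr (.inr ⟨u, hu, huw⟩)⟩
      exact mem_cluster_of_mem_hull hm ((h w hm).trans hw.2)
  · intro v hv
    obtain ⟨x, hx, hxv⟩ := conn_cluster hv
    refine ⟨x, hx, hxv.mono fun u hu => ⟨(mem_of_mem_cluster hu).1, ?_⟩⟩
    rw [← h u (cluster_subset_hull hu)]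
    exact (mem_of_mem_cluster hu).2

/-- The possible values of a cluster in a finite region. -/
theorem exists_finset_cluster (c : Bool) {R : Set Site} (hR : R.Finite) (X : Set Site) :
    ∃ I : Finset (Set Site), ∀ ω, cluster c R X ω ∈ I :=
  ⟨hR.finite_subsets.toFinset, fun ω => by
    rw [Set.Finite.mem_toFinset]
    exact fun v hv => (mem_of_mem_cluster hv).1⟩

/-- The lattice reflection exchanging the two sides of the line `2 * x + y = c`. -/
def mirror (c : ℤ) : Site ≃ Site where
  toFun v := (c - v.1 - v.2, v.2)
  invFun v := (c - v.1 - v.2, v.2)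
  left_inv v := Prod.ext (by simp only; ring) rfl
  right_inv v := Prod.ext (by simp only; ring) rfl

theorem mirror_apply (c : ℤ) (v : Site) : mirror c v = (c - v.1 - v.2, v.2) := rfl

theorem mirror_mirror (c : ℤ) (v : Site) : mirror c (mirror c v) = v := (mirror c).left_inv v

theorem isAut_mirror (c : ℤ) : IsAut (mirror c) := by
  intro u v
  simp only [adj_iff, mirror_apply]
  omega

/-- The row at height `y`. -/
def row (y : ℤ) : Set Site := {v | v.2 = y}

/-- The probability that no closed walk in `R` joins row `0` to row `n`. -/
noncomputable def blockProb (μ : Measure Config) (n : ℤ) (R : Set Site) : ℝ :=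
  μ.real (Cross false R (row 0) (row n))ᶜ

/-- The sites of `R` on the left of the line `2 * x + y = c`. -/
def leftHalf (c : ℤ) (R : Set Site) : Set Site := {v | v ∈ R ∧ 2 * v.1 + v.2 < c}

theorem exists_conn_hull {c : Bool} {R X : Set Site} {ω : Config} {u : Site}
    (hu : u ∈ hull R X (cluster c R X ω)) :
    ∃ x ∈ X, x ∈ R ∧ Conn (hull R X (cluster c R X ω)) x u := by
  obtain ⟨hR, h | h | ⟨w, hw, hwu⟩⟩ := id hu
  · obtain ⟨x, hx, h⟩ := conn_cluster h
    exact ⟨x, hx, (mem_of_mem_cluster h.left_mem).1, h.mono cluster_subset_hull⟩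
  · exact ⟨u, h, hR, .refl hu⟩
  · obtain ⟨x, hx, h⟩ := conn_cluster hw
    exact ⟨x, hx, (mem_of_mem_cluster h.left_mem).1, (h.mono cluster_subset_hull).step hwu hu⟩

section

variable {n c : ℤ} {R : Set Site}

/-- What is left of `R` after exploring `k` in the left half and reflecting. -/
def freshPart (c : ℤ) (R k : Set Site) : Set Site :=
  {v | v ∈ R ∧ v ∉ hull (leftHalf c R) (row 0) k ∧ mirror c v ∉ hull (leftHalf c R) (row 0) k}

/-- The neighbours of the hull of `k`. -/
def hullNbr (c : ℤ) (R k : Set Site) : Set Site :=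
  {v | ∃ u ∈ hull (leftHalf c R) (row 0) k, Adj u v}

/-- The right half of row `n`. -/
def topRight (n c : ℤ) : Set Site := {v | v.2 = n ∧ c ≤ 2 * v.1 + v.2}

theorem fresh_crossing (hc : Odd c) (hR : ∀ v ∈ R, mirror c v ∈ R) {ω : Config}
    (hK : Disjoint (cluster false (leftHalf c R) (row 0) ω) (row n))
    (h : ω ∈ Cross false R (row 0) (mirror c ⁻¹' topRight n c)) :
    ω ∈ Cross false (freshPart c R (cluster false (leftHalf c R) (row 0) ω))
      (mirror c ⁻¹' hullNbr c R (cluster false (leftHalf c R) (row 0) ω))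
      (mirror c ⁻¹' topRight n c) := by
  obtain ⟨b, hb, t, ht, hbt⟩ := h
  set k := cluster false (leftHalf c R) (row 0) ω with hk
  have htR := hbt.right_mem
  have hbR := hbt.left_mem
  simp only [topRight, mirror_apply, Set.mem_preimage, Set.mem_ofPred_eq] at ht
  have htF : t ∈ freshPart c R k := by
    refine ⟨htR.1, fun h => ?_, fun h => ?_⟩
    · exact Set.disjoint_left.1 hK (mem_cluster_of_mem_hull h htR.2) ht.1
    · have := h.1.2
      simp only [mirror_apply] at this
      omega
  have hbF : b ∉ freshPart c R k := by
    rintro ⟨_, h1, h2⟩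
    have hb0 : b.2 = 0 := hb
    rcases lt_or_ge (2 * b.1 + b.2) c with h | h
    · exact h1 ⟨⟨hbR.1, h⟩, .inr (.inl hb)⟩
    · refine h2 ⟨⟨hR b hbR.1, ?_⟩, .inr (.inl hb)⟩
      obtain ⟨d, rfl⟩ := hc
      simp only [mirror_apply]
      omega
  obtain ⟨f, z, hf, hfz, hz, hzF⟩ := hbt.symm.exists_exit htF hbF
  have hfF : f ∈ freshPart c R k := hf.right_mem.2
  refine ⟨f, ?_, t, ?_, hf.symm.mono fun v hv => ⟨hv.2, hv.1.2⟩⟩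
  · by_cases h1 : mirror c z ∈ hull (leftHalf c R) (row 0) k
    · exact ⟨mirror c z, h1, ((isAut_mirror c z f).2 hfz.symm)⟩
    · have h2 : z ∈ hull (leftHalf c R) (row 0) k := by
        by_contra h2
        exact hzF ⟨hz.1, h2, h1⟩
      have h3 : z ∈ k := mem_cluster_of_mem_hull h2 hz.2
      have h4 : c ≤ 2 * f.1 + f.2 := by
        by_contra h4
        exact hfF.2.1 ⟨⟨hfF.1, by omega⟩, .inr (.inr ⟨z, h3, hfz.symm⟩)⟩
      have h5 : 2 * z.1 + z.2 < c := h2.1.2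
      rw [adj_iff] at hfz
      refine ⟨z, h2, ?_⟩
      have h6 : mirror c f ≠ z := by
        rintro h
        exact hfF.2.2 (h ▸ h2)
      rw [Ne, Prod.ext_iff, mirror_apply] at h6
      rw [adj_iff, mirror_apply]
      simp only at h6 ⊢
      omega
  · exact ht

theorem not_both_fresh (hn : ∀ v ∈ R, 0 ≤ v.2 ∧ v.2 ≤ n) (hR : ∀ v ∈ R, mirror c v ∈ R)
    {ω₀ ω : Config} {k : Set Site} (hk : cluster false (leftHalf c R) (row 0) ω₀ = k)
    (h1 : ω ∈ Cross false (freshPart c R k) (mirror c ⁻¹' hullNbr c R k)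
      (mirror c ⁻¹' topRight n c))
    (h2 : ω ∈ Cross true (freshPart c R k) (hullNbr c R k) (topRight n c)) : False := by
  subst hk
  set k := cluster false (leftHalf c R) (row 0) ω₀ with hk
  set K := hull (leftHalf c R) (row 0) k with hK
  obtain ⟨f, ⟨u, hu, huf⟩, t, ht, hft⟩ := h1
  obtain ⟨g, ⟨w, hw, hwg⟩, s, hs, hgs⟩ := h2
  obtain ⟨x, hx, hxD, hxu⟩ := exists_conn_hull hu
  obtain ⟨y, hy, hyD, hyw⟩ := exists_conn_hull hw
  have hA : Conn (K ∪ {v | v ∈ freshPart c R k ∧ ω v = true}) y s :=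
    ((hyw.mono Set.subset_union_left).step hwg (.inr hgs.left_mem)).trans
      (hgs.mono Set.subset_union_right)
  have hxu' : Conn (mirror c ⁻¹' K) (mirror c x) (mirror c u) :=
    hxu.map (fun a b => (isAut_mirror c a b).2) fun v hv => by
      rw [Set.mem_preimage, mirror_mirror]
      exact hv
  have huf' : Adj (mirror c u) f := by
    rw [← isAut_mirror c, mirror_mirror]
    exact huf
  have hB : Conn (mirror c ⁻¹' K ∪ {v | v ∈ freshPart c R k ∧ ω v = false}) (mirror c x) t :=
    ((hxu'.mono Set.subset_union_left).step huf' (.inr hft.left_mem)).trans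
      (hft.mono Set.subset_union_right)
  have hy0 : y.2 = 0 := hy
  have hx0 : x.2 = 0 := hx
  have hAR : ∀ v ∈ K ∪ {v | v ∈ freshPart c R k ∧ ω v = true}, y.2 ≤ v.2 ∧ v.2 ≤ s.2 := by
    intro v hv
    rw [hy0, hs.1]
    rcases hv with h | h
    · exact hn v h.1.1
    · exact hn v h.1.1
  obtain ⟨S, hS⟩ := exists_isRightSide hA hAR
  have hBA : ∀ v ∈ mirror c ⁻¹' K ∪ {v | v ∈ freshPart c R k ∧ ω v = false},
      v ∉ K ∪ {v | v ∈ freshPart c R k ∧ ω v = true} ∧ y.2 ≤ v.2 ∧ v.2 ≤ s.2 := by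
    intro v hv
    rw [hy0, hs.1]
    rcases hv with h | h
    · refine ⟨?_, ?_⟩
      · rintro (h' | h')
        · have e1 := h.1.2
          have e2 := h'.1.2
          simp only [mirror_apply] at e1
          omega
        · exact h'.1.2.2 h
      · have := hn _ (hR _ h.1.1)
        rwa [mirror_mirror] at this
    · refine ⟨?_, hn v h.1.1⟩
      rintro (h' | h')
      · exact h.1.2.1 h'
      · exact absurd (h.2.symm.trans h'.2) (by simp)
  have hmem := hS.mem_iff_of_conn hB hBA
  have ht' := ht
  simp only [topRight, mirror_apply, Set.mem_preimage, Set.mem_ofPred_eq] at ht'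
  have e1 := hs.1
  have e2 := hs.2
  rw [hS.bot _ (hBA _ hB.left_mem).1 (by rw [mirror_apply]; simp only; omega),
    hS.top _ (hBA _ hB.right_mem).1 (by omega), mirror_apply] at hmem
  have e3 := hxD.2
  have e4 := hyD.2
  simp only at hmem
  omega

variable {μ : Measure Config} (hμ : IsBernoulliHalf μ)
include hμ

theorem blockProb_half_le (hc : Odd c) (hfin : R.Finite) (hn : ∀ v ∈ R, 0 ≤ v.2 ∧ v.2 ≤ n)
    (hR : ∀ v ∈ R, mirror c v ∈ R) :
    blockProb μ n (leftHalf c R) / 2 ≤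
      μ.real (Cross false R (row 0) (mirror c ⁻¹' topRight n c))ᶜ := by
  have := hμ.1
  set D := leftHalf c R with hD
  have hDfin : D.Finite := hfin.subset fun v hv => hv.1
  set K := cluster false D (row 0) with hK
  obtain ⟨I, hI⟩ := exists_finset_cluster false hDfin (row 0)
  let G : Set (Set Site) := {k | Disjoint k (row n) ∧ ∃ ω, K ω = k}
  let C : Set Site → Set Config := fun k =>
    Cross false (freshPart c R k) (mirror c ⁻¹' hullNbr c R k) (mirror c ⁻¹' topRight n c)
  have hFfin : ∀ k, (freshPart c R k).Finite := fun k => hfin.subset fun v hv => hv.1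
  have hCle : ∀ k ∈ G, μ.real (C k) ≤ 1 / 2 * μ.real (Set.univ : Set Config) := by
    rintro k ⟨_, ω₀, hk⟩
    have hpre : mirror c ⁻¹' freshPart c R k = freshPart c R k := by
      ext v
      simp only [Set.mem_preimage, freshPart, Set.mem_ofPred_eq, mirror_mirror]
      refine ⟨fun h => ⟨?_, h.2.2, h.2.1⟩, fun h => ⟨hR v h.1, h.2.2, h.2.1⟩⟩
      have := hR _ h.1
      rwa [mirror_mirror] at this
    have e := prob_cross_map hμ (isAut_mirror c) true false (hullNbr c R k) (topRight n c) (hFfin k)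
    rw [hpre] at e
    have hd : Disjoint (C k) (Cross true (freshPart c R k) (hullNbr c R k) (topRight n c)) :=
      Set.disjoint_left.2 fun ω h1 h2 => not_both_fresh hn hR hk h1 h2
    have h1 := measureReal_union (μ := μ) hd ((dep_cross _ _ _ _).measurableSet (hFfin k))
    have h2 := (prob_nonneg_le_one hμ (C k ∪ Cross true (freshPart c R k) (hullNbr c R k)
      (topRight n c))).2
    rw [probReal_univ]
    have e' : μ.real (C k) = μ.real (Cross true (freshPart c R k) (hullNbr c R k) (topRight n c)) :=
      e
    linarith
  have hle := prob_explore_le hμ hI G (fun k => hull D (row 0) k) (fun k => freshPart c R k) C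
    (fun _ => Set.univ) (1 / 2) (fun k _ => hDfin.subset (hull_subset _ _ _)) (fun k _ => hFfin k)
    (fun k _ => Set.disjoint_left.2 fun v h1 h2 => h2.2.1 h1) (fun k _ => dep_cluster_eq _ _ _ _)
    (fun k _ => dep_cross _ _ _ _) (fun k _ ω ω' _ h => h) hCle
  have hq : (Cross false D (row 0) (row n))ᶜ = {ω | K ω ∈ G ∧ ω ∈ (Set.univ : Set Config)} := by
    ext ω
    simp only [Set.mem_compl_iff, Set.mem_ofPred_eq, Set.mem_univ, and_true, G]
    constructor
    · refine fun h => ⟨Set.disjoint_left.2 ?_, ω, rfl⟩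
      rintro v ⟨x, hx, hv⟩ hvn
      exact h ⟨x, hx, v, hvn, hv⟩
    · rintro ⟨h, _⟩ ⟨x, hx, v, hvn, hv⟩
      exact Set.disjoint_left.1 h ⟨x, hx, hv⟩ hvn
  rw [← hq] at hle
  have hsub : (Cross false D (row 0) (row n))ᶜ ⊆
      (Cross false R (row 0) (mirror c ⁻¹' topRight n c))ᶜ ∪ {ω | K ω ∈ G ∧ ω ∈ C (K ω)} := by
    intro ω hω
    by_cases h : ω ∈ Cross false R (row 0) (mirror c ⁻¹' topRight n c)
    · right
      rw [hq] at hω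
      exact ⟨hω.1, fresh_crossing hc hR hω.1.1 h⟩
    · exact .inl h
  have h1 := (prob_mono hμ hsub).trans (measureReal_union_le _ _)
  simp only [blockProb]
  linarith

theorem blockProb_ge (hc : Odd c) (hfin : R.Finite) (hn : ∀ v ∈ R, 0 ≤ v.2 ∧ v.2 ≤ n)
    (hR : ∀ v ∈ R, mirror c v ∈ R) :
    (blockProb μ n (leftHalf c R)) ^ 2 / 4 ≤ blockProb μ n R := by
  have h1 := blockProb_half_le hμ hc hfin hn hR
  have e := prob_cross_map hμ (isAut_mirror c) false false (row 0) (topRight n c) hfin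
  have hpre : mirror c ⁻¹' R = R := by
    ext v
    refine ⟨fun h => ?_, fun h => hR v h⟩
    have := hR _ h
    rwa [mirror_mirror] at this
  have hrow : mirror c ⁻¹' row 0 = row 0 := rfl
  rw [hpre, hrow, Bool.false_xor] at e
  have hdep := fun X Y => (dep_cross false R X Y)
  have h2 := harris hμ hfin (hdep (row 0) (mirror c ⁻¹' topRight n c)).compl
    (hdep (row 0) (topRight n c)).compl
    (.inl ⟨(isLowerSet_cross _ _ _).compl, (isLowerSet_cross _ _ _).compl⟩)
  have e' : μ.real (Cross false R (row 0) (topRight n c))ᶜ =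
      μ.real (Cross false R (row 0) (mirror c ⁻¹' topRight n c))ᶜ := by
    rw [prob_compl hμ (hdep _ _) hfin, prob_compl hμ (hdep _ _) hfin, e]
  rw [e'] at h2
  have h3 : blockProb μ n R ≥ μ.real ((Cross false R (row 0) (mirror c ⁻¹' topRight n c))ᶜ ∩
      (Cross false R (row 0) (topRight n c))ᶜ) := by
    refine prob_mono hμ ?_
    rintro ω ⟨h4, h5⟩ ⟨a, ha, b, hb, hab⟩
    have hb' : b.2 = n := hb
    rcases le_total c (2 * b.1 + b.2) with h | h
    · exact h5 ⟨a, ha, b, ⟨hb', h⟩, hab⟩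
    · refine h4 ⟨a, ha, b, ⟨hb', ?_⟩, hab⟩
      simp only [mirror_apply]
      omega
  have h4 : 0 ≤ blockProb μ n (leftHalf c R) := (prob_nonneg_le_one hμ _).1
  nlinarith

end

theorem blockProb_rect {μ : Measure Config} {n l : ℤ} (hn : 0 ≤ n) (hl : 0 ≤ l) :
    blockProb μ n (rect 0 l 0 n) = crossProb μ l n := by
  have h := HC_eq_compl hl hn true
  rw [crossProb, h]
  rfl

/-- The trapezoid with bottom side `[0, c]`, height `n` and top side `[0, c - n]`. -/
def trapezoid (n c : ℤ) : Set Site := {v | 0 ≤ v.2 ∧ v.2 ≤ n ∧ 0 ≤ v.1 ∧ v.1 + v.2 ≤ c}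

theorem finite_trapezoid (n c : ℤ) : (trapezoid n c).Finite := by
  refine (finite_rect 0 c 0 n).subset ?_
  rintro v ⟨h1, h2, h3, h4⟩
  exact ⟨h3, by omega, h1, h2⟩

section

variable {μ : Measure Config} (hμ : IsBernoulliHalf μ)
include hμ

theorem blockProb_anti (n : ℤ) {R R' : Set Site} (h : R ⊆ R') :
    blockProb μ n R' ≤ blockProb μ n R :=
  prob_mono hμ (Set.compl_subset_compl.2 (cross_mono h subset_rfl subset_rfl))

theorem blockProb_trapezoid_ge {n c : ℤ} (hc : Odd c) {R : Set Site}
    (hR : leftHalf c (trapezoid n c) ⊆ R) :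
    (blockProb μ n R) ^ 2 / 4 ≤ blockProb μ n (trapezoid n c) := by
  have h := blockProb_ge hμ hc (finite_trapezoid n c) (fun v hv => ⟨hv.1, hv.2.1⟩) (by
    rintro v ⟨h1, h2, h3, h4⟩
    simp only [trapezoid, mirror_apply, Set.mem_ofPred_eq]
    omega)
  have h1 := blockProb_anti hμ n hR
  have h2 : 0 ≤ blockProb μ n R := (prob_nonneg_le_one hμ _).1
  nlinarith

end

/-- Trapezoids of any aspect ratio are blocked with uniformly positive probability. -/
theorem exists_le_blockProb_trapezoid (j : ℕ) : ∃ κ : ℝ, 0 < κ ∧ ∀ μ, IsBernoulliHalf μ →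
    ∀ n : ℤ, 0 ≤ n →
      ∃ c : ℤ, Odd c ∧ n + 2 ^ j * n + 1 ≤ c ∧ κ ≤ blockProb μ n (trapezoid n c) := by
  induction j with
  | zero =>
    refine ⟨1 / 16, by norm_num, fun μ hμ n hn => ⟨2 * n + 1, ⟨n, rfl⟩, by omega, ?_⟩⟩
    have h := blockProb_trapezoid_ge hμ (n := n) (c := 2 * n + 1) ⟨n, rfl⟩ (R := rect 0 n 0 n) (by
      rintro v ⟨⟨h1, h2, h3, h4⟩, h5⟩
      exact ⟨h3, by omega, h1, h2⟩)
    rw [blockProb_rect hn hn, crossProb_self hμ hn] at h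
    linarith
  | succ j ih =>
    obtain ⟨κ, hκ, H⟩ := ih
    refine ⟨κ ^ 2 / 4, by positivity, fun μ hμ n hn => ?_⟩
    obtain ⟨c, -, hc, hq⟩ := H μ hμ n hn
    obtain ⟨c', hodd, h1, h2⟩ : ∃ c' : ℤ, Odd c' ∧ 2 * c - n - 1 ≤ c' ∧ c' ≤ 2 * c - n := by
      rcases Int.even_or_odd (2 * c - n) with h | h
      · exact ⟨2 * c - n - 1, h.sub_odd odd_one, by omega, by omega⟩
      · exact ⟨2 * c - n, h, by omega, by omega⟩
    refine ⟨c', hodd, by rw [pow_succ]; linarith, ?_⟩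
    have h := blockProb_trapezoid_ge hμ (n := n) (c := c') hodd (R := trapezoid n c) (by
      rintro v ⟨⟨h1, h2, h3, h4⟩, h5⟩
      exact ⟨h1, h2, h3, by omega⟩)
    nlinarith

/-- Russo-Seymour-Welsh estimate. -/
theorem exists_le_crossProb (j : ℕ) : ∃ κ : ℝ, 0 < κ ∧ ∀ μ, IsBernoulliHalf μ →
    ∀ n l : ℤ, 0 ≤ n → 0 ≤ l → l ≤ 2 ^ j * n → κ ≤ crossProb μ l n := by
  obtain ⟨κ, hκ, H⟩ := exists_le_blockProb_trapezoid j
  refine ⟨κ, hκ, fun μ hμ n l hn hl hln => ?_⟩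
  obtain ⟨c, -, hc, hq⟩ := H μ hμ n hn
  rw [← blockProb_rect hn hl]
  refine hq.trans (blockProb_anti hμ n ?_)
  rintro v ⟨h1, h2, h3, h4⟩
  exact ⟨h3, h4, h1, by linarith⟩

/-- A walk through a horizontal strip contains a crossing of the strip. -/
theorem Conn.exists_strip_crossing {A : Set Site} {a b : Site} {y0 y1 : ℤ} (h : Conn A a b)
    (h01 : y0 ≤ y1) (ha : a.2 ≤ y0) (hb : y1 ≤ b.2) :
    ∃ p q, p.2 = y0 ∧ q.2 = y1 ∧ Conn {v | v ∈ A ∧ y0 ≤ v.2 ∧ v.2 ≤ y1} p q := by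
  by_contra! hno
  have key :
      b.2 < y0 ∨ (b.2 ≤ y1 ∧ ∃ p, p.2 = y0 ∧ Conn {v | v ∈ A ∧ y0 ≤ v.2 ∧ v.2 ≤ y1} p b) := by
    refine h.rec_on (P := fun b => b.2 < y0 ∨
      (b.2 ≤ y1 ∧ ∃ p, p.2 = y0 ∧ Conn {v | v ∈ A ∧ y0 ≤ v.2 ∧ v.2 ≤ y1} p b)) ?_ ?_
    · rcases ha.lt_or_eq with h1 | h1
      · exact .inl h1
      · exact .inr ⟨by omega, a, h1, .refl ⟨h.1, by omega, by omega⟩⟩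
    · intro u v hu huv hv ih
      have huv' := huv
      rw [adj_iff] at huv'
      rcases lt_or_ge v.2 y0 with h1 | h1
      · exact .inl h1
      right
      rcases ih with h2 | ⟨h2, p, hp, hpu⟩
      · exact ⟨by omega, v, by omega, .refl ⟨hv, by omega, by omega⟩⟩
      · have := hno p u hp
        have h3 : u.2 ≠ y1 := fun h => this h hpu
        exact ⟨by omega, p, hp, hpu.step huv ⟨hv, by omega, by omega⟩⟩
  rcases key with h1 | ⟨h1, p, hp, hpb⟩
  · omega
  · exact hno p b hp (by omega) hpb

theorem sum_prob_le_sum_prob {μ : Measure Config} (hμ : IsBernoulliHalf μ) {ι κ : Type}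
    (s : Finset ι) (t : Finset κ) (E : ι → Set Config) (F : κ → Set Config)
    (hE : ∀ i ∈ s, MeasurableSet (E i)) (hF : ∀ i ∈ t, MeasurableSet (F i))
    (h : ∀ ω, ∀ u ⊆ s, (∀ i ∈ u, ω ∈ E i) → ∃ v ⊆ t, (∀ i ∈ v, ω ∈ F i) ∧ u.card ≤ v.card) :
    ∑ i ∈ s, μ.real (E i) ≤ ∑ i ∈ t, μ.real (F i) := by
  classical
  have := hμ.1
  have e : ∀ {α : Type} (s : Finset α) (E : α → Set Config), (∀ i ∈ s, MeasurableSet (E i)) →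
      Integrable (fun ω => ∑ i ∈ s, (E i).indicator (fun _ => (1 : ℝ)) ω) μ ∧
      ∑ i ∈ s, μ.real (E i) = ∫ ω, ∑ i ∈ s, (E i).indicator (fun _ => (1 : ℝ)) ω ∂μ := by
    intro α s E hE
    have hint : ∀ i ∈ s, Integrable (fun ω => (E i).indicator (fun _ => (1 : ℝ)) ω) μ :=
      fun i hi => (integrable_const 1).indicator (hE i hi)
    refine ⟨integrable_finsetSum s hint, ?_⟩
    rw [integral_finsetSum s hint]
    refine Finset.sum_congr rfl fun i hi => ?_
    rw [integral_indicator (hE i hi)]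
    simp [measureReal_def]
  have e1 := e s E hE
  have e2 := e t F hF
  rw [e1.2, e2.2]
  refine integral_mono e1.1 e2.1 fun ω => ?_
  simp only [Set.indicator_apply, Finset.sum_boole]
  obtain ⟨v, hvt, hvF, hv⟩ := h ω (s.filter (ω ∈ E ·)) (Finset.filter_subset _ _)
    fun i hi => (Finset.mem_filter.1 hi).2
  exact_mod_cast hv.trans (Finset.card_le_card fun i hi => Finset.mem_filter.2 ⟨hvt hi, hvF i hi⟩)

open Classical in
/-- The number of closed clusters of `F` reaching `T` which are discovered when exploring
successively from the seeds of a list. -/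
noncomputable def reachCount (T : Set Site) (ω : Config) : List Site → Set Site → ℕ
  | [], _ => 0
  | b :: l, F => (if (cluster false F {b} ω ∩ T).Nonempty then 1 else 0) +
      reachCount T ω l (F \ hull F {b} (cluster false F {b} ω))

theorem dep_reachCount (T : Set Site) (l : List Site) (F : Set Site) (k : ℕ) :
    Dep F {ω | k ≤ reachCount T ω l F} := by
  have key : ∀ (l : List Site) (F : Set Site) (ω ω' : Config), (∀ v ∈ F, ω v = ω' v) →
      reachCount T ω l F = reachCount T ω' l F := by
    intro l
    induction l with
    | nil => exact fun _ _ _ _ => rfl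
    | cons b l ih =>
      intro F ω ω' h
      have e : cluster false F {b} ω' = cluster false F {b} ω :=
        dep_cluster_eq false F {b} _ ω ω' (fun v hv => h v hv.1) rfl
      rw [reachCount, reachCount, e, ih _ ω ω' fun v hv => h v hv.1]
  intro ω ω' h h1
  simp only [Set.mem_ofPred_eq] at h1 ⊢
  rwa [← key l F ω ω' h]

theorem cross_of_reachCount {T : Set Site} {ω : Config} {l : List Site} {F : Set Site}
    (h : 1 ≤ reachCount T ω l F) : ω ∈ Cross false F {v | v ∈ l} T := by
  induction l generalizing F with
  | nil => simp [reachCount] at h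
  | cons b l ih =>
    rw [reachCount] at h
    split_ifs at h with hb
    · obtain ⟨v, ⟨x, hx, hv⟩, hvT⟩ := hb
      exact ⟨x, by simp_all, v, hvT, hv⟩
    · rw [zero_add] at h
      refine cross_mono (fun v hv => hv.1) ?_ subset_rfl (ih h)
      intro v hv
      exact List.mem_cons_of_mem _ hv

theorem card_le_reachCount {T : Set Site} {ω : Config} {l : List Site} {F : Set Site}
    (s : Finset Site) (hsl : ∀ v ∈ s, v ∈ l)
    (hT : ∀ v ∈ s, ∃ t ∈ T, Conn {u | u ∈ F ∧ ω u = false} v t)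
    (hd : ∀ u ∈ s, ∀ v ∈ s, Conn {u | u ∈ F ∧ ω u = false} u v → u = v) :
    s.card ≤ reachCount T ω l F := by
  classical
  induction l generalizing F s with
  | nil =>
    have : s = ∅ := Finset.eq_empty_of_forall_notMem fun v hv => by simpa using hsl v hv
    simp [this]
  | cons b l ih =>
    rw [reachCount]
    set K := cluster false F {b} ω with hK
    have hmem : ∀ v ∈ s, v ∉ K → v ∈ l ∧
        ∃ t ∈ T, Conn {u | u ∈ F \ hull F {b} K ∧ ω u = false} v t := by
      intro v hv hvK
      obtain ⟨t, ht, hvt⟩ := hT v hv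
      have hout : ∀ u, Conn {u | u ∈ F ∧ ω u = false} v u → u ∉ hull F {b} K := by
        intro u hu h
        obtain ⟨x, hx, hxu⟩ := mem_cluster_of_mem_hull h hu.right_mem.2
        exact hvK ⟨x, hx, hxu.trans hu.symm⟩
      refine ⟨(List.mem_cons.1 (hsl v hv)).resolve_left ?_, t, ht, hvt.within.mono fun u hu => ?_⟩
      · rintro rfl
        exact hvK ⟨v, rfl, .refl hvt.left_mem⟩
      · exact ⟨⟨hu.right_mem.1, hout u hu⟩, hu.right_mem.2⟩
    have h1 : (s.filter (· ∉ K)).card ≤ reachCount T ω l (F \ hull F {b} K) := by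
      refine ih _ (fun v hv => ?_) (fun v hv => ?_) fun u hu v hv huv => ?_
      · have := Finset.mem_filter.1 hv
        exact (hmem v this.1 this.2).1
      · have := Finset.mem_filter.1 hv
        exact (hmem v this.1 this.2).2
      · exact hd u (Finset.mem_filter.1 hu).1 v (Finset.mem_filter.1 hv).1
          (huv.mono fun w hw => ⟨hw.1.1, hw.2⟩)
    have h2 : (s.filter (· ∈ K)).card ≤ if (K ∩ T).Nonempty then 1 else 0 := by
      split_ifs with hKT
      · rw [Finset.card_le_one]
        intro u hu v hv
        obtain ⟨hu, x, hx, hxu⟩ := Finset.mem_filter.1 hu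
        obtain ⟨hv, y, hy, hyv⟩ := Finset.mem_filter.1 hv
        rw [Set.mem_singleton_iff.1 hx] at hxu
        rw [Set.mem_singleton_iff.1 hy] at hyv
        exact hd u hu v hv (hxu.symm.trans hyv)
      · rw [Nat.le_zero, Finset.card_eq_zero, Finset.filter_eq_empty_iff]
        rintro v hv ⟨x, hx, hxv⟩
        obtain ⟨t, ht, hvt⟩ := hT v hv
        exact hKT ⟨t, ⟨x, hx, hxv.trans hvt⟩, ht⟩
    have h3 := Finset.card_filter_add_card_filter_not (s := s) (· ∈ K)
    omega

section

variable {μ : Measure Config} (hμ : IsBernoulliHalf μ)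
include hμ

theorem prob_reachCount_le {Q B T : Set Site} (hQ : Q.Finite) (l : List Site) (hl : ∀ v ∈ l, v ∈ B)
    {F : Set Site} (hF : F ⊆ Q) (k : ℕ) :
    μ.real {ω | k + 1 ≤ reachCount T ω l F} ≤
      μ.real (Cross false Q B T) ^ k * μ.real {ω | 1 ≤ reachCount T ω l F} := by
  have := hμ.1
  set θ := μ.real (Cross false Q B T) with hθ
  have hθ0 : 0 ≤ θ := measureReal_nonneg
  induction l generalizing F k with
  | nil => simp [reachCount]
  | cons b l ih =>
    have hl' : ∀ v ∈ l, v ∈ B := fun v hv => hl v (List.mem_cons_of_mem _ hv)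
    have hone : ∀ F ⊆ Q, μ.real {ω | 1 ≤ reachCount T ω l F} ≤ θ := by
      intro F hF
      refine prob_mono hμ fun ω hω => ?_
      exact cross_mono hF hl' subset_rfl (cross_of_reachCount hω)
    have hpow : ∀ F ⊆ Q, ∀ k, μ.real {ω | k ≤ reachCount T ω l F} ≤ θ ^ k := by
      intro F hF k
      cases k with
      | zero => simp
      | succ k =>
        refine (ih hl' hF k).trans ?_
        rw [pow_succ]
        exact mul_le_mul_of_nonneg_left (hone F hF) (pow_nonneg hθ0 k)
    have hFfin := hQ.subset hF
    obtain ⟨I, hI⟩ := exists_finset_cluster false hFfin {b}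
    set K := cluster false F {b} with hK
    let hit : Set (Set Site) := {k | (k ∩ T).Nonempty}
    let C : ℕ → Set Site → Set Config := fun j k => {ω | j ≤ reachCount T ω l (F \ hull F {b} k)}
    have hcmp : ∀ (G : Set (Set Site)) (C C' : Set Site → Set Config) (a : ℝ),
        (∀ k, Dep (F \ hull F {b} k) (C k)) → (∀ k, Dep (F \ hull F {b} k) (C' k)) →
        (∀ k, μ.real (C k) ≤ a * μ.real (C' k)) →
        μ.real {ω | K ω ∈ G ∧ ω ∈ C (K ω)} ≤ a * μ.real {ω | K ω ∈ G ∧ ω ∈ C' (K ω)} := by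
      intro G C C' a hC hC' h
      exact prob_explore_le hμ hI G (fun k => hull F {b} k) (fun k => F \ hull F {b} k) C C' a
        (fun k _ => hFfin.subset (hull_subset _ _ _)) (fun k _ => hFfin.subset fun v hv => hv.1)
        (fun k _ => Set.disjoint_sdiff_right) (fun k _ => dep_cluster_eq _ _ _ _)
        (fun k _ => hC k) (fun k _ => hC' k) fun k _ => h k
    have h1 := hcmp hit (C k) (fun _ => Set.univ) (θ ^ k) (fun _ => dep_reachCount _ _ _ _)
      (fun _ _ _ _ h => h) (fun k' => by
        rw [probReal_univ, mul_one]
        exact hpow _ (fun v hv => hF hv.1) k)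
    have h2 := hcmp hitᶜ (C (k + 1)) (C 1) (θ ^ k) (fun _ => dep_reachCount _ _ _ _)
      (fun _ => dep_reachCount _ _ _ _) (fun k' => ih hl' (fun v hv => hF hv.1) k)
    have h3 : {ω | k + 1 ≤ reachCount T ω (b :: l) F} ⊆
        {ω | K ω ∈ hit ∧ ω ∈ C k (K ω)} ∪ {ω | K ω ∈ hitᶜ ∧ ω ∈ C (k + 1) (K ω)} := by
      intro ω hω
      simp only [Set.mem_ofPred_eq, reachCount] at hω
      by_cases h : K ω ∈ hit
      · left
        refine ⟨h, ?_⟩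
        have h' : (cluster false F {b} ω ∩ T).Nonempty := h
        rw [if_pos h'] at hω
        simp only [C, Set.mem_ofPred_eq, hK]
        omega
      · right
        refine ⟨h, ?_⟩
        have h' : ¬ (cluster false F {b} ω ∩ T).Nonempty := h
        rw [if_neg h'] at hω
        simp only [C, Set.mem_ofPred_eq, hK]
        omega
    have h4 : {ω | 1 ≤ reachCount T ω (b :: l) F} =
        {ω | K ω ∈ hit ∧ ω ∈ (Set.univ : Set Config)} ∪ {ω | K ω ∈ hitᶜ ∧ ω ∈ C 1 (K ω)} := by
      ext ω
      simp only [Set.mem_ofPred_eq, reachCount, Set.mem_union, Set.mem_univ, and_true,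
        Set.mem_compl_iff, C, hit, hK]
      split_ifs with h
      · simp [h]
      · simp [h]
    have hmeas : MeasurableSet {ω | K ω ∈ hit ∧ ω ∈ (Set.univ : Set Config)} := by
      refine Dep.measurableSet (S := F) (fun ω ω' h h1 => ⟨?_, trivial⟩) hFfin
      have e : K ω' = K ω := dep_cluster_eq false F {b} _ ω ω' (fun v hv => h v hv.1) rfl
      rw [e]
      exact h1.1
    have h5 : μ.real {ω | 1 ≤ reachCount T ω (b :: l) F} =
        μ.real {ω | K ω ∈ hit ∧ ω ∈ (Set.univ : Set Config)} +
          μ.real {ω | K ω ∈ hitᶜ ∧ ω ∈ C 1 (K ω)} := by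
      rw [h4, Set.union_comm, measureReal_union _ hmeas, add_comm]
      rw [Set.disjoint_left]
      exact fun ω h6 h7 => h6.1 h7.1
    have h6 := (prob_mono hμ h3).trans (measureReal_union_le _ _)
    rw [h5]
    linarith

end

section

variable {μ : Measure Config} (hμ : IsBernoulliHalf μ)
include hμ

theorem prob_HC_diff (x0 x1 : ℤ) {y y0 y1 : ℤ} (hy : y ≤ y0) :
    μ.real (HC true x0 x1 y y1 \ HC true x0 x1 y0 y1) =
      crossProb μ (x1 - x0) (y1 - y) - crossProb μ (x1 - x0) (y1 - y0) := by
  have := hμ.1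
  rw [measureReal_sdiff _ ((dep_HC _ _ _ _ _).measurableSet (finite_rect _ _ _ _)), prob_HC hμ,
    prob_HC hμ]
  refine cross_mono ?_ subset_rfl subset_rfl
  rintro v ⟨h1, h2, h3, h4⟩
  exact ⟨h1, h2, hy.trans h3, h4⟩

omit hμ in
theorem card_slide_le_reachCount {w h m : ℤ} {J : ℕ} (hw : 0 ≤ w) (hm : 1 ≤ m) (hJ : J * m ≤ h)
    {l : List Site} (hl : ∀ v ∈ rect 0 w (J * m) h, v.2 = J * m → v ∈ l) (ω : Config) (s : Finset ℕ)
    (hs : ∀ j ∈ s, j < J ∧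
      ω ∈ HC true 0 w (j * m) (j * m + h) \ HC true 0 w ((j + 1) * m) (j * m + h)) :
    s.card ≤ reachCount {v | v.2 = h} ω l (rect 0 w (J * m) h) := by
  classical
  have hjm : ∀ j ∈ s, 0 ≤ (j : ℤ) * m ∧ ((j : ℤ) + 1) * m ≤ J * m := by
    intro j hj
    have h1 := (hs j hj).1
    exact ⟨by positivity, by gcongr; exact_mod_cast h1⟩
  have key : ∀ j ∈ s, ∃ p t a e : Site, p.2 = J * m ∧ t.2 = h ∧ a.2 = (j + 1) * m ∧
      e.2 = j * m + h ∧
      Conn {v | v ∈ rect 0 w (J * m) h ∧ ω v = false} p t ∧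
      Conn {v | v ∈ rect 0 w ((j + 1) * m) (j * m + h) ∧ ω v = false} a p ∧
      Conn {v | v ∈ rect 0 w ((j + 1) * m) (j * m + h) ∧ ω v = false} a e := by
    intro j hj
    have h1 := hjm j hj
    obtain ⟨a, ha, e, he, hae⟩ := (HC_or_VC hw (by lia) true ω).resolve_left (hs j hj).2.2
    rw [Set.mem_ofPred_eq] at ha he
    obtain ⟨p, t, hp, ht, hpt⟩ := hae.within.exists_strip_crossing hJ (by omega) (by omega)
    refine ⟨p, t, a, e, hp, ht, ha, he, hpt.mono ?_, hpt.left_mem.1, hae⟩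
    rintro v ⟨hv, hv1, hv2⟩
    obtain ⟨⟨h3, h4, -, -⟩, h5⟩ := hv.right_mem
    exact ⟨⟨h3, h4, hv1, hv2⟩, h5⟩
  choose! p t a e hp ht ha he hpt hap hae using key
  have hlt : ∀ i ∈ s, ∀ j ∈ s, i < j →
      ¬ Conn {v | v ∈ rect 0 w (J * m) h ∧ ω v = false} (p i) (p j) := by
    intro i hi j hj hij hc
    have hi1 := hjm i hi
    have hj1 := hjm j hj
    have hij1 : ((i : ℤ) + 1) * m ≤ j * m := by
      gcongr
      exact_mod_cast hij
    have hsub : ∀ y0 y1, (i + 1) * m ≤ y0 → y1 ≤ j * m + h →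
        {v | v ∈ rect 0 w y0 y1 ∧ ω v = false} ⊆
        {v | v ∈ rect 0 w ((i + 1) * m) (j * m + h) ∧ ω v = false} := by
      rintro y0 y1 h1 h2 v ⟨⟨h3, h4, h5, h6⟩, h7⟩
      exact ⟨⟨h3, h4, h1.trans h5, h6.trans h2⟩, h7⟩
    have hconn : Conn {v | v ∈ rect 0 w ((i + 1) * m) (j * m + h) ∧ ω v = false} (a i) (e j) := by
      refine ((hap i hi).mono (hsub _ _ le_rfl (by lia))).trans
        ((hc.mono (hsub _ _ (by lia) (by lia))).trans ?_)
      exact ((hap j hj).symm.trans (hae j hj)).mono (hsub _ _ (by lia) le_rfl)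
    obtain ⟨u, v, hu, hv, huv⟩ := hconn.exists_strip_crossing (y0 := j * m) (y1 := j * m + h)
      (by lia) (by rw [ha i hi]; exact hij1) (he j hj).ge
    refine not_HC_and_VC (hs j hj).2.1 ⟨u, hu, v, hv, huv.mono ?_⟩
    rintro z ⟨⟨⟨h3, h4, -, -⟩, h5⟩, h6, h7⟩
    exact ⟨⟨h3, h4, h6, h7⟩, h5⟩
  have hinj : ∀ i ∈ s, ∀ j ∈ s,
      Conn {v | v ∈ rect 0 w (J * m) h ∧ ω v = false} (p i) (p j) → i = j := by
    intro i hi j hj hc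
    rcases lt_trichotomy i j with h1 | h1 | h1
    · exact absurd hc (hlt i hi j hj h1)
    · exact h1
    · exact absurd hc.symm (hlt j hj i hi h1)
  rw [← Finset.card_image_of_injOn (s := s) (f := p) fun i hi j hj hij => hinj i hi j hj (by
    rw [← hij]; exact .refl (hpt i hi).left_mem)]
  refine card_le_reachCount _ ?_ ?_ ?_
  · intro v hv
    obtain ⟨i, hi, rfl⟩ := Finset.mem_image.1 hv
    exact hl _ (hpt i hi).left_mem.1 (hp i hi)
  · intro v hv
    obtain ⟨i, hi, rfl⟩ := Finset.mem_image.1 hv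
    exact ⟨t i, ht i hi, hpt i hi⟩
  · intro u hu v hv huv
    obtain ⟨i, hi, rfl⟩ := Finset.mem_image.1 hu
    obtain ⟨j, hj, rfl⟩ := Finset.mem_image.1 hv
    rw [hinj i hi j hj huv]

/-- Changing the height of a rectangle slightly barely changes its crossing probability. -/
theorem crossProb_sub_le {w h m : ℤ} {J : ℕ} (hw : 0 ≤ w) (hm : 1 ≤ m) (hJ : J * m ≤ h) :
    J * (crossProb μ w h - crossProb μ w (h - m)) * crossProb μ w (h - J * m) ≤ 1 := by
  classical
  have := hμ.1
  have hQ := finite_rect 0 w (J * m) h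
  have hB : {v | v ∈ rect 0 w (J * m) h ∧ v.2 = J * m}.Finite := hQ.subset fun v hv => hv.1
  set l := hB.toFinset.toList with hl
  have hmem : ∀ v, v ∈ l ↔ v ∈ rect 0 w (J * m) h ∧ v.2 = J * m := by simp [hl]
  let E : ℕ → Set Config := fun j =>
    HC true 0 w (j * m) (j * m + h) \ HC true 0 w ((j + 1) * m) (j * m + h)
  let F : ℕ → Set Config := fun k =>
    {ω | k + 1 ≤ reachCount {v | v.2 = h} ω l (rect 0 w (J * m) h)}
  have hle := sum_prob_le_sum_prob hμ (Finset.range J) (Finset.range J) E F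
    (fun j _ => ((dep_HC _ _ _ _ _).measurableSet (finite_rect _ _ _ _)).diff
      ((dep_HC _ _ _ _ _).measurableSet (finite_rect _ _ _ _)))
    (fun k _ => (dep_reachCount _ _ _ _).measurableSet hQ) fun ω u hu huE => by
      have hcard : u.card ≤ J := by simpa using Finset.card_le_card hu
      refine ⟨Finset.range u.card, Finset.range_subset_range.2 hcard, fun k hk => ?_,
        (Finset.card_range _).ge⟩
      refine (Finset.mem_range.1 hk).trans_le ?_
      exact card_slide_le_reachCount hw hm hJ (fun v hv hv' => (hmem v).2 ⟨hv, hv'⟩) ω u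
        fun j hj => ⟨Finset.mem_range.1 (hu hj), huE j hj⟩
  have hE : ∀ j ∈ Finset.range J, μ.real (E j) = crossProb μ w h - crossProb μ w (h - m) := by
    intro j _
    rw [prob_HC_diff hμ 0 w (by lia), sub_zero]
    congr 2 <;> ring
  rw [Finset.sum_congr rfl hE, Finset.sum_const, Finset.card_range, nsmul_eq_mul] at hle
  set θ := μ.real (VC false 0 w (J * m) h) with hθ
  have hθ1 := prob_nonneg_le_one hμ (VC false 0 w (J * m) h)
  rw [← hθ] at hθ1
  have hF : ∀ k, μ.real (F k) ≤ θ ^ k := by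
    intro k
    refine (prob_reachCount_le hμ hQ (B := {v | v.2 = J * m}) l (fun v hv => ((hmem v).1 hv).2)
      subset_rfl k).trans ?_
    exact mul_le_of_le_one_right (pow_nonneg hθ1.1 k) (prob_nonneg_le_one hμ _).2
  have hθ2 : crossProb μ w (h - J * m) = 1 - θ := by
    have := crossProb_add hμ hw (sub_nonneg.2 hJ)
    rw [hθ, prob_VC hμ, sub_zero]
    linarith
  rw [hθ2]
  calc _ ≤ (∑ k ∈ Finset.range J, θ ^ k) * (1 - θ) :=
        mul_le_mul_of_nonneg_right (hle.trans (Finset.sum_le_sum fun k _ => hF k)) (by linarith)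
    _ = 1 - θ ^ J := by rw [geom_sum_mul_neg]
    _ ≤ 1 := sub_le_self _ (pow_nonneg hθ1.1 J)

end

theorem Mn_lt_iff {n m : ℕ} (hm : m ≤ 2 * n) (ω : Config) :
    Mn n ω < m ↔ ∃ v, Pivotal n ω v ∧ v.2 < -n + m := by
  classical
  rw [Mn]
  split_ifs with h
  · have hge : ∀ v ∈ Qset n ω, -(n : ℤ) ≤ v.2 := by
      rintro v ⟨⟨p, hp, hv⟩, -⟩
      exact (hp.1.2 v hv).2.2.1
    have hne : {h : ℕ | ∃ x : ℤ, (x, -(n : ℤ) + (h : ℤ)) ∈ Qset n ω}.Nonempty := by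
      obtain ⟨v, hv⟩ := h
      refine ⟨(v.2 + n).toNat, v.1, ?_⟩
      rwa [Int.toNat_of_nonneg (by have := hge v hv; omega), add_comm v.2, neg_add_cancel_left]
    constructor
    · intro hlt
      obtain ⟨x, hx⟩ := Nat.sInf_mem hne
      exact ⟨_, hx, by simpa using hlt⟩
    · rintro ⟨v, hv, hlt⟩
      have h0 := hge v hv
      have hmem : (v.2 + n).toNat ∈ {h : ℕ | ∃ x : ℤ, (x, -(n : ℤ) + (h : ℤ)) ∈ Qset n ω} := by
        refine ⟨v.1, ?_⟩
        rwa [Int.toNat_of_nonneg (by omega), add_comm v.2, neg_add_cancel_left]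
      exact (Nat.sInf_le hmem).trans_lt (by omega)
  · refine iff_of_false (by omega) ?_
    rintro ⟨v, hv, -⟩
    exact h ⟨v, hv⟩

theorem HC_of_path {n : ℤ} {ω : Config} {p : List Site} (h : HorizCrossing (-n) n (-n) n ω p) :
    ω ∈ HC true (-n) n (-n) n := by
  obtain ⟨⟨hp, hpR⟩, hop, ⟨a, ha, hpa⟩, b, hb, hpb⟩ := h
  exact ⟨a, ha.2, b, hb.2, conn_of_path ⟨hp, fun v hv => ⟨hpR v hv, hop v hv⟩⟩ hpa hpb⟩

/-- A criterion for pivotality. -/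
theorem pivotal_of_conn {n : ℤ} {ω : Config} {u v w s t : Site} {A B : Set Site}
    (hω : ω ∈ HC true (-n) n (-n) n) (hv : v ∈ rect (-n) n (-n) n)
    (hA : ∀ z ∈ A, z ∈ rect (-n) n (-n) n ∧ ω z = false)
    (hB : ∀ z ∈ B, z ∈ rect (-n) n (-n) n ∧ ω z = false) (hd : Disjoint A B)
    (hu : Adj v u) (hut : Conn A u t) (ht : t.2 = n) (hw : Adj v w) (hws : Conn B w s)
    (hs : s.2 = -n) : Pivotal n ω v := by
  obtain ⟨a, ha, b, hb, hab⟩ := hω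
  obtain ⟨p, ⟨hp, hpA⟩, hpa, hpb⟩ := exists_path_of_conn hab
  obtain ⟨q₁, ⟨hq₁, hq₁A⟩, hq₁u, hq₁t⟩ := exists_path_of_conn hut
  obtain ⟨q₂, ⟨hq₂, hq₂B⟩, hq₂w, hq₂s⟩ := exists_path_of_conn hws
  refine ⟨⟨p, ⟨⟨hp, fun v hv => (hpA v hv).1⟩, fun v hv => (hpA v hv).2,
    ⟨a, ⟨hab.left_mem.1, ha⟩, hpa⟩, b, ⟨hab.right_mem.1, hb⟩, hpb⟩, ?_⟩,
    q₁, q₂, ⟨hq₁, fun z hz => (hA z (hq₁A z hz)).1⟩, fun z hz => (hA z (hq₁A z hz)).2,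
    ⟨u, hu, hq₁u⟩, ⟨t, ⟨(hA t hut.right_mem).1, ht⟩, hq₁t⟩,
    ⟨hq₂, fun z hz => (hB z (hq₂B z hz)).1⟩, fun z hz => (hB z (hq₂B z hz)).2,
    ⟨w, hw, hq₂w⟩, ⟨s, ⟨(hB s hws.right_mem).1, hs⟩, hq₂s⟩, ?_⟩
  · by_contra hvp
    have h1 : Conn {z | (z ∈ rect (-n) n (-n) n ∧ ω z = false) ∨ z = v} s t := by
      refine ((hws.symm.mono fun z hz => .inl (hB z hz)).step hw.symm (.inr rfl)).trans ?_
      exact (Conn.single (.inr rfl) hu (.inl (hA u hut.left_mem))).trans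
        (hut.mono fun z hz => .inl (hA z hz))
    have h2 : Conn {z | z ∈ p} a b := conn_of_path ⟨hp, fun z hz => hz⟩ hpa hpb
    refine not_disjoint_crossings h1 h2 ?_ (fun z hz => (hpA z hz).1) hs ht ha hb ?_
    · rintro z (hz | rfl)
      exacts [hz.1, hv]
    · rw [Set.disjoint_left]
      rintro z (hz | rfl) hzp
      · have := (hpA z hzp).2
        rw [hz.2] at this
        cases this
      · exact hvp hzp
  · intro z h1 h2
    exact Set.disjoint_left.1 hd (hq₁A z h1) (hq₂B z h2)

theorem exists_pivotal_subset {n m : ℤ} (hm : m ≤ 2 * n) :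
    {ω | ∃ v, Pivotal n ω v ∧ v.2 < -n + m} ⊆
      HC true (-n) n (-n) n \ HC true (-n) n (-n + m) n := by
  rintro ω ⟨v, ⟨⟨p, hp, hvp⟩, q₁, q₂, ⟨hq₁, hq₁R⟩, hq₁c, ⟨u, hu, hq₁u⟩, ⟨t, ht, hq₁t⟩, ⟨hq₂, hq₂R⟩,
    hq₂c, ⟨w, hw, hq₂w⟩, ⟨s, hs, hq₂s⟩, -⟩, hvm⟩
  refine ⟨HC_of_path hp, fun hHC => ?_⟩
  have h1 : Conn {z | (z ∈ rect (-n) n (-n) n ∧ ω z = false) ∨ z = v} s v :=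
    (conn_of_path ⟨hq₂, fun z hz => .inl ⟨hq₂R z hz, hq₂c z hz⟩⟩ hq₂w hq₂s).symm.step
      (Adj.symm hw) (.inr rfl)
  have h2 : Conn {z | (z ∈ rect (-n) n (-n) n ∧ ω z = false) ∨ z = v} u t :=
    conn_of_path ⟨hq₁, fun z hz => .inl ⟨hq₁R z hz, hq₁c z hz⟩⟩ hq₁u hq₁t
  obtain ⟨a, b, ha, hb, hab⟩ := ((h1.step hu h2.left_mem).trans h2).exists_strip_crossing
    (y0 := -n + m) (y1 := n) (by omega) (by linarith [hs.1.2.2.1, hvm, hs.2, (hp.1.2 v hvp).2.2.1])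
    ht.2.ge
  refine not_HC_and_VC hHC ⟨a, ha, b, hb, hab.mono ?_⟩
  rintro z ⟨⟨hz, hzc⟩ | rfl, h3, h4⟩
  · exact ⟨⟨hz.1, hz.2.1, h3, h4⟩, hzc⟩
  · omega

theorem exists_prob_pivotal_le : ∃ C : ℝ, ∀ μ, IsBernoulliHalf μ → ∀ n m : ℕ, 1 ≤ m → m ≤ n →
    μ.real {ω | ∃ v, Pivotal n ω v ∧ v.2 < -n + m} ≤ C * m / n := by
  obtain ⟨κ, hκ, H⟩ := exists_le_crossProb 1
  refine ⟨2 / κ, fun μ hμ n m hm hmn => ?_⟩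
  refine (prob_mono hμ (exists_pivotal_subset (by omega))).trans ?_
  rw [prob_HC_diff hμ _ _ (by omega)]
  have hJ : (n / m) * m ≤ n := Nat.div_mul_le_self n m
  have hJ2 : n ≤ 2 * (n / m) * m := by
    have h1 := Nat.lt_div_mul_add (a := n) hm
    have h2 : 1 * m ≤ n / m * m := Nat.mul_le_mul_right m ((Nat.one_le_div_iff hm).2 hmn)
    lia
  have hJ' : ((n / m : ℕ) : ℤ) * m ≤ n := by exact_mod_cast hJ
  have h := crossProb_sub_le hμ (w := 2 * n) (h := 2 * n) (m := m) (J := n / m) (by omega)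
    (by omega) (by omega)
  have h1 := H μ hμ (2 * n - (n / m : ℕ) * m) (2 * n) (by omega) (by omega) (by omega)
  have h2 := crossProb_mono_right hμ (w := 2 * n) (h := 2 * n - m) (h' := 2 * n) (by omega)
  have e1 : (n : ℤ) - -n = 2 * n := by ring
  have e2 : (n : ℤ) - (-n + m) = 2 * n - m := by ring
  rw [e1, e2]
  set δ := crossProb μ (2 * n) (2 * n) - crossProb μ (2 * n) (2 * n - m) with hδ
  have hδ0 : 0 ≤ δ := sub_nonneg.2 h2
  have hn : (0 : ℝ) < n := by exact_mod_cast hm.trans hmn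
  have h3 : ((n / m : ℕ) : ℝ) * δ * κ ≤ 1 :=
    (mul_le_mul_of_nonneg_left h1 (by positivity)).trans h
  have h4 : (n : ℝ) ≤ 2 * (n / m : ℕ) * m := by exact_mod_cast hJ2
  rw [le_div_iff₀ hn, div_mul_eq_mul_div, le_div_iff₀ hκ]
  calc δ * n * κ ≤ δ * (2 * (n / m : ℕ) * m) * κ := by gcongr
    _ = 2 * m * ((n / m : ℕ) * δ * κ) := by ring
    _ ≤ 2 * m * 1 := by gcongr
    _ = _ := by ring

/-- The sites of row `y` between columns `x0` and `x1`. -/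
def rowSeg (x0 x1 y : ℤ) : Set Site := {v | x0 ≤ v.1 ∧ v.1 ≤ x1 ∧ v.2 = y}

theorem conn_rowSeg {x0 x1 y : ℤ} {u v : Site} (hu : u ∈ rowSeg x0 x1 y) (hv : v ∈ rowSeg x0 x1 y) :
    Conn (rowSeg x0 x1 y) u v := by
  obtain ⟨ux, uy⟩ := u
  obtain ⟨vx, vy⟩ := v
  obtain ⟨hu1, hu2, hu3⟩ := hu
  obtain ⟨hv1, hv2, hv3⟩ := hv
  dsimp only at *
  subst hu3 hv3
  rcases le_total ux vx with h | h
  · exact conn_horizontal h fun t h1 h2 => ⟨hu1.trans h1, h2.trans hv2, rfl⟩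
  · exact Conn.symm (conn_horizontal h fun t h1 h2 => ⟨hv1.trans h1, h2.trans hu2, rfl⟩)

theorem rowSeg_subset_rect {x0 x1 y y0 y1 : ℤ} (h0 : y0 ≤ y) (h1 : y ≤ y1) :
    rowSeg x0 x1 y ⊆ rect x0 x1 y0 y1 :=
  fun _ h => ⟨h.1, h.2.1, h0.trans h.2.2.ge, h.2.2.le.trans h1⟩

theorem exists_mem_cluster {x0 x1 y0 y1 : ℤ} (hx : x0 ≤ x1) (hy : y0 ≤ y1) {ω : Config}
    (h : ω ∉ HC true x0 x1 y0 y1) :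
    ∃ s ∈ cluster false (rect x0 x1 y0 y1) (row y1) ω, s.2 = y0 := by
  obtain ⟨a, ha, b, hb, hab⟩ := (HC_or_VC hx hy true ω).resolve_left h
  exact ⟨a, ⟨b, hb, hab.symm⟩, ha⟩

theorem HC_of_forall_mem_cluster {x0 x1 y0 y1 : ℤ} (hx : x0 ≤ x1) (hy : y0 ≤ y1) {ω : Config}
    (h : ∀ s ∈ cluster false (rect x0 x1 y0 y1) (row y1) ω, s.2 ≠ y0) :
    ω ∈ HC true x0 x1 y0 y1 := by
  by_contra hω
  obtain ⟨s, hs, hs'⟩ := exists_mem_cluster hx hy hω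
  exact h s hs hs'

section

variable {μ : Measure Config} (hμ : IsBernoulliHalf μ)
include hμ

theorem prob_forall_eq (S : Finset Site) (b : Bool) :
    μ.real {ω | ∀ v ∈ S, ω v = b} = (1 / 2) ^ S.card := by
  rw [measureReal_def, hμ.2 S fun _ => b]
  simp

theorem prob_site (v : Site) (b : Bool) : μ.real {ω : Config | ω v = b} = 1 / 2 := by
  simpa using prob_forall_eq hμ {v} b

theorem crossProb_mul_le {w h d : ℤ} {J : ℕ} (hd : 0 ≤ d) (hJ : h + 1 ≤ J * d) :
    crossProb μ w h * (1 - crossProb μ w h) ≤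
      J * (crossProb μ w (h + d) - crossProb μ w h) := by
  have := hμ.1
  let A : ℕ → Set Config := fun j => HC true 0 w (j * d) (j * d + h)
  have hA : ∀ j : ℕ, Dep (rect 0 w (j * d) (j * d + h)) (A j) := fun j => dep_HC _ _ _ _ _
  have hP : ∀ j, μ.real (A j) = crossProb μ w h := by
    intro j
    rw [prob_HC hμ]
    congr 1 <;> ring
  have hstep : ∀ j, μ.real (A j \ A (j + 1)) ≤ crossProb μ w (h + d) - crossProb μ w h := by
    intro j
    have h1 := prob_HC_diff hμ 0 w (y := j * d) (y0 := (j + 1 : ℕ) * d) (y1 := (j + 1 : ℕ) * d + h)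
      (by push_cast; lia)
    have e : ((j + 1 : ℕ) : ℤ) * d + h - j * d = h + d := by push_cast; ring
    rw [e, add_sub_cancel_left, sub_zero] at h1
    rw [← h1]
    refine prob_mono hμ (Set.sdiff_subset_sdiff_left (cross_mono ?_ subset_rfl subset_rfl))
    rintro v ⟨h1, h2, h3, h4⟩
    exact ⟨h1, h2, h3, by push_cast; lia⟩
  have htel : ∀ J : ℕ, μ.real (A 0 \ A J) ≤ J * (crossProb μ w (h + d) - crossProb μ w h) := by
    intro J
    induction J with
    | zero => simp
    | succ J ih =>
      have h1 : A 0 \ A (J + 1) ⊆ (A 0 \ A J) ∪ (A J \ A (J + 1)) := by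
        intro ω hω
        by_cases h : ω ∈ A J
        · exact .inr ⟨h, hω.2⟩
        · exact .inl ⟨hω.1, h⟩
      have h2 := (prob_mono hμ h1).trans (measureReal_union_le _ _)
      have h3 := hstep J
      push_cast
      linarith
  refine le_trans (le_of_eq ?_) (htel J)
  rw [Set.sdiff_eq, prob_inter_of_disjoint hμ (hA 0) (hA J).compl (finite_rect _ _ _ _)
    (finite_rect _ _ _ _), prob_compl hμ (hA J) (finite_rect _ _ _ _), hP, hP]
  rw [Set.disjoint_left]
  rintro v ⟨-, -, -, h4⟩ ⟨-, -, h7, -⟩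
  simp only [Nat.cast_zero, zero_mul, zero_add] at h4
  omega

theorem prob_pivotal_bottom_ge {n : ℕ} (hn : 1 ≤ n) :
    μ.real (HC true (-n) n (-n) n \ HC true (-n) n (-n + 1) n) ≤
      2 * μ.real {ω | ∃ v, Pivotal n ω v ∧ v.2 < -n + 1} +
      (1 / 2) ^ (2 * n + 1) * μ.real (HC true (-n) n (-n + 1) n)ᶜ := by
  classical
  have := hμ.1
  set Λ := rect (-n) n (-n + 1) n with hΛ
  set R := rowSeg (-n) n (-n) with hR
  have hΛfin : Λ.Finite := finite_rect _ _ _ _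
  have hRfin : R.Finite := (finite_rect (-n) n (-n) n).subset (rowSeg_subset_rect le_rfl (by omega))
  have hdisj : Disjoint Λ R := by
    rw [Set.disjoint_left]
    rintro v ⟨-, -, h1, -⟩ ⟨-, -, h2⟩
    omega
  set K := cluster false Λ (row n) with hK
  obtain ⟨I, hI⟩ := exists_finset_cluster false hΛfin (row n)
  let bd : Set Site → Set Site := fun k => {v | v ∈ R ∧ ∃ u ∈ k, Adj v u}
  let G : Set (Set Site) := {k | ∃ w f, w ∈ bd k ∧ f ∈ R ∧ f ∉ bd k ∧ Adj w f}
  have hG : ∀ k ∈ G, ∃ w f, w ∈ bd k ∧ f ∈ R ∧ f ∉ bd k ∧ Adj w f := fun _ h => h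
  choose! w f hw hf hf' hwf using hG
  let C : Set Site → Set Config := fun k => {ω | ∀ v ∈ bd k, ω v = true}
  have hCdep : ∀ k, Dep (bd k) (C k) := fun k ω ω' h h1 v hv => (h v hv).symm.trans (h1 v hv)
  have hfdep : ∀ k, Dep {f k} {ω : Config | ω (f k) = false} := fun k ω ω' h h1 =>
    (h _ rfl).symm.trans h1
  have hbdR : ∀ k, bd k ⊆ R := fun k v hv => hv.1
  have h1 : μ.real {ω | K ω ∈ G ∧ ω ∈ C (K ω)} ≤
      2 * μ.real {ω | K ω ∈ G ∧ ω ∈ C (K ω) ∩ {ω | ω (f (K ω)) = false}} :=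
    prob_explore_le hμ hI G (fun k => hull Λ (row n) k) (fun _ => R) C
    (fun k => C k ∩ {ω | ω (f k) = false}) 2 (fun k _ => hΛfin.subset (hull_subset _ _ _))
    (fun _ _ => hRfin) (fun k _ => hdisj.mono_left (hull_subset _ _ _))
    (fun k _ => dep_cluster_eq _ _ _ _) (fun k _ => (hCdep k).mono (hbdR k))
    (fun k hk => ((hCdep k).mono (hbdR k)).inter
      ((hfdep k).mono (Set.singleton_subset_iff.2 (hf k hk))))
    fun k hk => by
      rw [prob_inter_of_disjoint hμ (hCdep k) (hfdep k) (hRfin.subset (hbdR k))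
        (Set.finite_singleton _) (Set.disjoint_singleton_right.2 (hf' k hk)), prob_site hμ]
      linarith
  have htop : ∀ ω, ∀ v ∈ K ω, ∃ t, t.2 = (n : ℤ) ∧ Conn (K ω) v t := by
    intro ω v hv
    obtain ⟨t, ht, htv⟩ := conn_cluster hv
    exact ⟨t, ht, htv.symm⟩
  have hΛsub : Λ ⊆ rect (-n) n (-n) n :=
    fun v hv => ⟨hv.1, hv.2.1, by have := hv.2.2.1; omega, hv.2.2.2⟩
  have h2 : {ω | K ω ∈ G ∧ ω ∈ C (K ω) ∩ {ω | ω (f (K ω)) = false}} ⊆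
      {ω | ∃ v, Pivotal n ω v ∧ v.2 < -n + 1} := by
    rintro ω ⟨hk, hC, hfω⟩
    obtain ⟨hwR, u, hu, hwu⟩ := hw _ hk
    obtain ⟨t, ht, hut⟩ := htop ω u hu
    refine ⟨w (K ω), ?_, by rw [hwR.2.2]; omega⟩
    refine pivotal_of_conn (A := K ω) (B := {f (K ω)}) ?_ (rowSeg_subset_rect le_rfl (by omega) hwR)
      (fun z hz => ⟨hΛsub (mem_of_mem_cluster hz).1, (mem_of_mem_cluster hz).2⟩) ?_ ?_ hwu hut ht
      (hwf _ hk) (.refl rfl) (hf _ hk).2.2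
    · by_contra hHC
      obtain ⟨a, ha, b, hb, hab⟩ := (HC_or_VC (by omega) (by omega) true ω).resolve_left hHC
      have hbK : b ∈ K ω := ⟨b, hb, .refl ⟨⟨hab.right_mem.1.1, hab.right_mem.1.2.1,
        by rw [show b.2 = n from hb]; omega, hb.le⟩, hab.right_mem.2⟩⟩
      have haK : a ∉ K ω := fun h => by
        have h1 := (mem_of_mem_cluster h).1.2.2.1
        have h2 : a.2 = -n := ha
        omega
      obtain ⟨z, z', hz, hzz', hz', hz'K⟩ := hab.symm.exists_exit hbK haK
      by_cases hzΛ : z' ∈ Λ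
      · obtain ⟨x, hx, hxz⟩ := hz.right_mem.2
        exact hz'K ⟨x, hx, hxz.step hzz' ⟨hzΛ, hz'.2⟩⟩
      · have hzR : z' ∈ R := by
          obtain ⟨⟨h1, h2, h3, h4⟩, -⟩ := hz'
          refine ⟨h1, h2, ?_⟩
          by_contra h5
          exact hzΛ ⟨h1, h2, by omega, h4⟩
        have := hC z' ⟨hzR, z, hz.right_mem.2, hzz'.symm⟩
        rw [hz'.2] at this
        cases this
    · rintro z rfl
      exact ⟨rowSeg_subset_rect le_rfl (by omega) (hf _ hk), hfω⟩
    · rw [Set.disjoint_singleton_right]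
      exact fun h => Set.disjoint_left.1 hdisj (mem_of_mem_cluster h).1 (hf _ hk)
  let S : Finset Site := (Finset.Icc (-n : ℤ) n).image fun x => (x, (-n : ℤ))
  have hS : S.card = 2 * n + 1 := by
    rw [Finset.card_image_of_injective _ fun x y h => congrArg Prod.fst h, Int.card_Icc]
    omega
  have hSR : ∀ v, v ∈ S ↔ v ∈ R := by
    rintro ⟨x, y⟩
    simp only [S, Finset.mem_image, Finset.mem_Icc, Prod.mk.injEq, R, rowSeg, Set.mem_ofPred_eq]
    constructor
    · rintro ⟨a, ha, rfl, rfl⟩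
      exact ⟨ha.1, ha.2, rfl⟩
    · rintro ⟨h1, h2, rfl⟩
      exact ⟨x, ⟨h1, h2⟩, rfl, rfl⟩
  have h3 : HC true (-n) n (-n) n \ HC true (-n) n (-n + 1) n ⊆
      {ω | K ω ∈ G ∧ ω ∈ C (K ω)} ∪
      ({ω | ∀ v ∈ S, ω v = true} ∩ (HC true (-n) n (-n + 1) n)ᶜ) := by
    rintro ω ⟨hω, hω'⟩
    have hC : ω ∈ C (K ω) := by
      rintro v ⟨hvR, u, hu, hvu⟩
      by_contra hv
      rw [Bool.not_eq_true] at hv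
      obtain ⟨t, ht, htu⟩ := hu
      refine not_HC_and_VC hω (cross_symm ⟨t, ht, v, hvR.2.2, (htu.mono ?_).step hvu.symm ?_⟩)
      · exact fun z hz => ⟨hΛsub hz.1, hz.2⟩
      · exact ⟨rowSeg_subset_rect le_rfl (by omega) hvR, hv⟩
    obtain ⟨s, hs, hs1⟩ := exists_mem_cluster (by omega) (by omega) hω'
    by_cases hall : ∀ v ∈ R, v ∈ bd (K ω)
    · exact .inr ⟨fun v hv => hC v (hall v ((hSR v).1 hv)), hω'⟩
    · push Not at hall
      obtain ⟨y, hy, hy'⟩ := hall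
      have hsΛ := (mem_of_mem_cluster hs).1
      have hsR : ((s.1, -n) : Site) ∈ R := ⟨hsΛ.1, hsΛ.2.1, rfl⟩
      obtain ⟨f, z, hf, hfz, hz, hz'⟩ := (conn_rowSeg hsR hy).exists_exit (F := bd (K ω))
        ⟨hsR, s, hs, adj_iff.2 (.inr (.inr (.inl ⟨rfl, hs1⟩)))⟩ hy'
      exact .inl ⟨⟨f, z, hf.right_mem.2, hz, hz', hfz⟩, hC⟩
  have h4 : μ.real ({ω | ∀ v ∈ S, ω v = true} ∩ (HC true (-n) n (-n + 1) n)ᶜ) =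
      (1 / 2) ^ (2 * n + 1) * μ.real (HC true (-n) n (-n + 1) n)ᶜ := by
    rw [prob_inter_of_disjoint hμ (S := R) (T := Λ) _ (dep_HC _ _ _ _ _).compl hRfin hΛfin
      hdisj.symm,
      prob_forall_eq hμ, hS]
    exact fun ω ω' h h1 v hv => (h v ((hSR v).1 hv)).symm.trans (h1 v hv)
  have h5 := (prob_mono hμ h3).trans (measureReal_union_le _ _)
  have h6 := prob_mono hμ h2
  rw [h4] at h5
  linarith

theorem prob_pivotal_bottom_ge_inv {n : ℕ} (hn : 1 ≤ n) :
    1 / (80 * n) ≤ μ.real {ω | ∃ v, Pivotal n ω v ∧ v.2 < -n + 1} := by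
  have h1 := prob_pivotal_bottom_ge hμ hn
  rw [prob_HC_diff hμ _ _ (by omega), prob_compl hμ (dep_HC _ _ _ _ _) (finite_rect _ _ _ _),
    prob_HC hμ] at h1
  have h2 := crossProb_mul_le hμ (w := 2 * n) (h := 2 * n - 1) (d := 1) (J := 2 * n) (by omega)
    (by push_cast; omega)
  have e1 : (n : ℤ) - -n = 2 * n := by ring
  have e2 : (n : ℤ) - (-n + 1) = 2 * n - 1 := by ring
  have h3 := crossProb_mono_right hμ (w := 2 * n) (h := 2 * n - 1) (h' := 2 * n) (by omega)
  have h4 := (prob_nonneg_le_one hμ (HC true 0 (2 * n) 0 (2 * n - 1))).1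
  change 0 ≤ crossProb μ _ _ at h4
  rw [sub_add_cancel] at h2
  rw [e1, e2] at h1
  rw [crossProb_self hμ (by omega)] at h1 h2 h3
  set g := crossProb μ (2 * n) (2 * n - 1)
  set p := μ.real {ω | ∃ v, Pivotal n ω v ∧ v.2 < -n + 1}
  have hn1 : (1 : ℝ) ≤ n := by exact_mod_cast hn
  have hpow : (1 / 2 : ℝ) ^ (2 * n + 1) ≤ 1 / (8 * n) := by
    rw [one_div_pow]
    refine one_div_le_one_div_of_le (by positivity) ?_
    have key : ∀ k : ℕ, 1 ≤ k → 8 * k ≤ 2 ^ (2 * k + 1) := by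
      intro k hk
      induction k, hk using Nat.le_induction with
      | base => norm_num
      | succ k hk ih =>
        rw [show 2 * (k + 1) + 1 = 2 * k + 1 + 2 by ring, pow_add]
        omega
    exact_mod_cast key n hn
  have h5 : (1 / 2 - g) * (10 * n) ≥ 1 := by
    push_cast at h2
    nlinarith
  have h6 : (1 / 2 : ℝ) ^ (2 * n + 1) * (1 - g) ≤ 1 / (8 * n) * (1 - g) :=
    mul_le_mul_of_nonneg_right hpow (by linarith)
  rw [div_le_iff₀ (by positivity)]
  have h7 : 1 / (8 * (n : ℝ)) * (1 - g) * (8 * n) = 1 - g := by field_simp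
  nlinarith

end

/-- A closed arch around the lower part of column `x`, standing on row `y`. -/
def Arch (x y a : ℤ) : Set Config :=
  HC false (x - 2 * a) (x + 2 * a) (y + a + 1) (y + 2 * a) ∩
    (VC false (x - 2 * a) (x - a) y (y + 2 * a) ∩ VC false (x + a) (x + 2 * a) y (y + 2 * a))

/-- A left-right walk of a rectangle meets any walk crossing the strip of that rectangle
inside its columns. -/
theorem exists_conn_of_crossings {A B : Set Site} {x0 x1 y0 y1 : ℤ} {a b p q : Site} (hy : y0 ≤ y1)
    (hA : Conn A a b) (hAR : A ⊆ rect x0 x1 y0 y1) (ha : a.1 = x0) (hb : b.1 = x1)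
    (hB : Conn B p q) (hBx : ∀ v ∈ B, x0 ≤ v.1 ∧ v.1 ≤ x1) (hp : p.2 ≤ y0) (hq : y1 ≤ q.2) :
    Conn (A ∪ B) p a := by
  obtain ⟨u, v, hu, hv, huv⟩ := hB.within.exists_strip_crossing hy hp hq
  have hnd := not_disjoint_crossings huv hA.within (fun z hz => ?_) (fun z hz => hAR hz.right_mem)
    hu hv ha hb
  · obtain ⟨z, hz1, hz2⟩ := Set.not_disjoint_iff.1 hnd
    exact (Conn.mono hz1.1 Set.subset_union_right).trans
      (Conn.symm (hz2.mono Set.subset_union_left))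
  · have := hBx z hz.1.right_mem
    exact ⟨this.1, this.2, hz.2⟩

theorem exists_conn_of_arch {x y a : ℤ} (ha : 1 ≤ a) {ω : Config} (h : ω ∈ Arch x y a) :
    ∃ D : Set Site, ∃ p q : Site, Conn D p q ∧ p.2 = y ∧ q.2 = y ∧ p.1 < x ∧ x < q.1 ∧
      ∀ v ∈ D, ω v = false ∧ v ∈ rect (x - 2 * a) (x + 2 * a) y (y + 2 * a) ∧
        ¬ (v.1 = x ∧ v.2 ≤ y + a) := by
  obtain ⟨⟨l, hl, r, hr, hlr⟩, ⟨p, hp, p', hp', hpp⟩, ⟨q, hq, q', hq', hqq⟩⟩ := h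
  have h1 := exists_conn_of_crossings (by omega) hlr (fun v hv => hv.1) hl hr hpp
    (fun v hv => by
      obtain ⟨⟨h1, h2, -, -⟩, -⟩ := hv
      omega) (by rw [show p.2 = y from hp]; omega) (by rw [show p'.2 = _ from hp'])
  have h2 := exists_conn_of_crossings (by omega) hlr (fun v hv => hv.1) hl hr hqq
    (fun v hv => by
      obtain ⟨⟨h1, h2, -, -⟩, -⟩ := hv
      omega) (by rw [show q.2 = y from hq]; omega) (by rw [show q'.2 = _ from hq'])
  refine ⟨_, p, q, (h1.mono Set.subset_union_left).trans (h2.mono Set.subset_union_right).symm, hp,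
    hq, ?_, ?_, ?_⟩
  · have := hpp.left_mem.1.2.1
    omega
  · have := hqq.left_mem.1.1
    omega
  · rintro v ((hv | hv) | (hv | hv)) <;> obtain ⟨⟨h1, h2, h3, h4⟩, h5⟩ := hv <;>
      exact ⟨h5, ⟨by omega, by omega, by omega, by omega⟩, by omega⟩

/-- A closed walk from the bottom row `-n` inside `F` reaching a neighbour of `H` of height
at most `h`. -/
def Reach (n h : ℤ) (F H : Set Site) : Set Config :=
  {ω | ∃ b f u, b.2 = -n ∧ f.2 ≤ -n + h ∧ u ∈ H ∧ Adj f u ∧ Conn {v | v ∈ F ∧ ω v = false} b f}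

theorem dep_reach (n h : ℤ) (F H : Set Site) : Dep F (Reach n h F H) := by
  rintro ω ω' hω ⟨b, f, u, hb, hf, hu, hfu, hbf⟩
  exact ⟨b, f, u, hb, hf, hu, hfu, hbf.mono fun v hv => ⟨hv.1, (hω v hv.1).symm.trans hv.2⟩⟩

theorem arch_subset_reach {n a : ℤ} (ha : 1 ≤ a) (han : 2 * a ≤ n) {H k : Set Site} {s t : Site}
    (hk : ∀ v ∈ k, v ∈ rect (-n) n (-n + 2) n) (hkH : k ⊆ H) (hH : ∀ v ∈ H, -n < v.2)
    (hs : s.2 = -n + a) (ht : t.2 = n) (hst : Conn k s t) :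
    Arch s.1 (-n) a ⊆ Reach n (2 * a) (rect (-n) n (-n) n \ H) H := by
  intro ω hω
  obtain ⟨D, p, q, hpq, hp, hq, hps, hsq, hD⟩ := exists_conn_of_arch ha hω
  set F := rect (-n) n (-n) n \ H with hF
  set A : Set Site := k ∪ {v | v.1 = s.1 ∧ -n ≤ v.2 ∧ v.2 ≤ -n + a} with hA
  have hsΛ := hk s hst.left_mem
  have hconn : Conn A (s.1, -n) t := by
    have h1 : Conn A (s.1, -n) (s.1, -n + a) :=
      conn_vertical (by omega) fun y h1 h2 => .inr ⟨rfl, h1, h2⟩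
    rw [← hs] at h1
    exact h1.trans (hst.mono Set.subset_union_left)
  have hAR : ∀ v ∈ A, v ∈ rect (-n) n (-n) n := by
    rintro v (hv | ⟨h1, h2, h3⟩)
    · obtain ⟨h1, h2, h3, h4⟩ := hk v hv
      exact ⟨h1, h2, by omega, h4⟩
    · exact ⟨h1 ▸ hsΛ.1, h1 ▸ hsΛ.2.1, h2, by omega⟩
  obtain ⟨S, hS⟩ := exists_isRightSide hconn fun v hv => by
    rw [ht]
    exact (hAR v hv).2.2
  have hDA : ∀ v ∈ D, v ∈ A → v ∈ k := by
    rintro v hv (h | ⟨h1, -, h3⟩)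
    · exact h
    · exact absurd ⟨h1, h3⟩ (hD v hv).2.2
  have hDF : ∀ v ∈ D ∩ F, v ∉ A ∧ ((s.1, -n) : Site).2 ≤ v.2 ∧ v.2 ≤ t.2 := by
    rintro v ⟨h1, h2⟩
    exact ⟨fun h => h2.2 (hkH (hDA v h1 h)), h2.1.2.2.1, h2.1.2.2.2.trans ht.ge⟩
  have hbot : ∀ v, v.2 = -n → v.1 ≠ s.1 → v ∉ A := by
    rintro v h1 h2 (h | h)
    · have := (hk v h).2.2.1
      omega
    · exact h2 h.1
  have hpS : p ∉ S := fun h => by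
    have := (hS.bot p (hbot p hp hps.ne) hp).1 h
    exact lt_asymm this hps
  have hqS : q ∈ S := (hS.bot q (hbot q hq hsq.ne') hq).2 hsq
  obtain ⟨z, hzD, hzk⟩ : ∃ z ∈ D, z ∈ k := by
    by_contra! h
    refine hpS ((hS.mem_iff_of_conn hpq fun v hv => ⟨fun h' => h v hv (hDA v hv h'), ?_⟩).2 hqS)
    have := (hD v hv).2.1.2.2
    exact ⟨this.1, by omega⟩
  have finish : ∀ b, Conn D p b → b.2 = -n → b ∈ rect (-n) n (-n) n →
      (∀ f f', Conn (D ∩ F) b f → Adj f f' → f' ∈ D → f' ∈ rect (-n) n (-n) n) →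
      ω ∈ Reach n (2 * a) F H := by
    intro b hb hbn hbΛ hexit
    have hzD' : ∃ z ∈ k, Conn D b z := by
      by_contra! h
      have h1 : ∀ v ∈ {v | Conn D b v}, v ∉ A ∧ ((s.1, -n) : Site).2 ≤ v.2 ∧ v.2 ≤ t.2 := by
        intro v hv
        have := (hD v (Conn.right_mem hv)).2.1.2.2
        exact ⟨fun h' => h v (hDA v (Conn.right_mem hv) h') hv, this.1, by omega⟩
      have h2 := hS.mem_iff_of_conn (hb.symm.within) h1
      have h3 := hS.mem_iff_of_conn ((hb.symm.trans hpq).within) h1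
      exact hpS (h2.1 (h3.2 hqS))
    obtain ⟨z, hz, hbz⟩ := hzD'
    obtain ⟨f, f', hbf, hff', hf'D, hf'F⟩ := hbz.exists_exit (F := F)
      ⟨hbΛ, fun h => by have := hH b h; omega⟩ (fun h => h.2 (hkH hz))
    have hf'Λ := hexit f f' hbf hff' hf'D
    have hf'H : f' ∈ H := by
      by_contra h
      exact hf'F ⟨hf'Λ, h⟩
    exact ⟨b, f, f', hbn, (hD f hbf.right_mem.1).2.1.2.2.2, hf'H, hff',
      hbf.mono fun v hv => ⟨hv.2, (hD v hv.1).1⟩⟩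
  rcases le_or_gt s.1 0 with hs0 | hs0
  · refine finish q hpq hq ?_ ?_
    · have := (hD q hpq.right_mem).2.1.2.1
      have := hsΛ.1
      exact ⟨by omega, by omega, hq.ge, by omega⟩
    · intro f f' hf hff' hf'
      have h1 := (hD f' hf').2.1
      refine ⟨?_, by linarith [h1.2.1], h1.2.2.1, by linarith [h1.2.2.2]⟩
      by_contra! h2
      have h3 : f.1 ≤ -n := by
        rw [adj_iff] at hff'
        omega
      exact hS.left f (hDF f hf.right_mem).1 (fun v hv => h3.trans (hAR v hv).1)
        ((hS.mem_iff_of_conn hf hDF).1 hqS)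
  · refine finish p (.refl hpq.left_mem) hp ?_ ?_
    · have := (hD p hpq.left_mem).2.1.1
      have := hsΛ.2.1
      exact ⟨by omega, by omega, hp.ge, by omega⟩
    · intro f f' hf hff' hf'
      have h1 := (hD f' hf').2.1
      refine ⟨by linarith [h1.1], ?_, h1.2.2.1, by linarith [h1.2.2.2]⟩
      by_contra! h2
      have h3 : n ≤ f.1 := by
        rw [adj_iff] at hff'
        omega
      have h4 := hDF f hf.right_mem
      exact hpS ((hS.mem_iff_of_conn hf hDF).2
        (hS.right f h4.1 h4.2.1 h4.2.2 fun v hv => (hAR v hv).2.1.trans h3))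

theorem pivotal_of_reach {n h : ℤ} (hn : h + 1 < 2 * n) {ω : Config}
    (hK : ∀ v ∈ cluster false (rect (-n) n (-n + 1) n) (row n) ω, -n + 2 ≤ v.2)
    (hω : ω ∈ HC true (-n) n (-n) n)
    (hR : ω ∈ Reach n h (rect (-n) n (-n) n \ hull (rect (-n) n (-n + 1) n) (row n)
      (cluster false (rect (-n) n (-n + 1) n) (row n) ω))
      (hull (rect (-n) n (-n + 1) n) (row n) (cluster false (rect (-n) n (-n + 1) n) (row n) ω))) :
    ∃ v, Pivotal n ω v ∧ v.2 ≤ -n + h + 1 := by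
  set Λ := rect (-n) n (-n + 1) n with hΛ
  set K := cluster false Λ (row n) ω with hKdef
  obtain ⟨b, f, u, hb, hf, hu, hfu, hbf⟩ := hR
  have hΛsub : Λ ⊆ rect (-n) n (-n) n :=
    fun v hv => ⟨hv.1, hv.2.1, by have := hv.2.2.1; omega, hv.2.2.2⟩
  have hf2 := hbf.right_mem.1
  have hfu' := adj_iff.1 hfu
  have hfK : ∀ v ∈ K, ¬ Adj v f := by
    intro v hv hvf
    have h1 := hK v hv
    have hvf' := adj_iff.1 hvf
    exact hf2.2 ⟨⟨hf2.1.1, hf2.1.2.1, by omega, hf2.1.2.2.2⟩, .inr (.inr ⟨v, hv, hvf⟩)⟩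
  obtain ⟨w, hw, hwu⟩ : ∃ w ∈ K, Adj w u := by
    obtain ⟨-, h | h | h⟩ := hu
    · exact absurd hfu.symm (hfK u h)
    · have : u.2 = n := h
      omega
    · exact h
  obtain ⟨t, ht, htw⟩ := conn_cluster hw
  refine ⟨u, pivotal_of_conn hω (hΛsub hu.1)
    (fun z hz => ⟨hΛsub (mem_of_mem_cluster hz).1, (mem_of_mem_cluster hz).2⟩)
    (fun z hz => ⟨hz.1.1, hz.2⟩) ?_ hwu.symm htw.symm ht hfu.symm hbf.symm hb, by omega⟩
  rw [Set.disjoint_left]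
  exact fun v h1 h2 => h2.1.2 (cluster_subset_hull h1)

section

variable {μ : Measure Config} (hμ : IsBernoulliHalf μ)
include hμ

theorem prob_arch_ge {κ : ℝ} (hκ : 0 ≤ κ) {a : ℤ} (ha : 1 ≤ a)
    (h1 : κ ≤ crossProb μ (4 * a) (a - 1))
    (h2 : κ ≤ crossProb μ (2 * a) a) (x y : ℤ) : κ ^ 3 ≤ μ.real (Arch x y a) := by
  have hfin := finite_rect (x - 2 * a) (x + 2 * a) y (y + 2 * a)
  have hH : Dep (rect (x - 2 * a) (x + 2 * a) y (y + 2 * a))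
      (HC false (x - 2 * a) (x + 2 * a) (y + a + 1) (y + 2 * a)) :=
    (dep_HC _ _ _ _ _).mono fun v hv => ⟨hv.1, hv.2.1, by linarith [hv.2.2.1], hv.2.2.2⟩
  have hV : ∀ x0 x1, x - 2 * a ≤ x0 → x1 ≤ x + 2 * a →
      Dep (rect (x - 2 * a) (x + 2 * a) y (y + 2 * a)) (VC false x0 x1 y (y + 2 * a)) :=
    fun x0 x1 h1 h2 => (dep_VC _ _ _ _ _).mono fun v hv => ⟨h1.trans hv.1, hv.2.1.trans h2, hv.2.2⟩
  have hV1 := hV (x - 2 * a) (x - a) le_rfl (by omega)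
  have hV2 := hV (x + a) (x + 2 * a) (by omega) le_rfl
  have e1 := harris hμ hfin hV1 hV2 (.inr ⟨isLowerSet_cross _ _ _, isLowerSet_cross _ _ _⟩)
  have e2 := harris hμ hfin hH (hV1.inter hV2)
    (.inr ⟨isLowerSet_cross _ _ _, (isLowerSet_cross _ _ _).inter (isLowerSet_cross _ _ _)⟩)
  refine le_trans ?_ e2
  rw [prob_VC hμ, prob_VC hμ] at e1
  rw [prob_HC hμ]
  have r1 : x + 2 * a - (x - 2 * a) = 4 * a := by ring
  have r2 : y + 2 * a - (y + a + 1) = a - 1 := by ring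
  have r3 : x - a - (x - 2 * a) = a := by ring
  have r4 : x + 2 * a - (x + a) = a := by ring
  rw [r1, r2]
  rw [r3, r4, add_sub_cancel_left] at e1
  calc κ ^ 3 = κ * (κ * κ) := by ring
    _ ≤ crossProb μ (4 * a) (a - 1) * (crossProb μ (2 * a) a * crossProb μ (2 * a) a) := by
      have p1 := hκ.trans h1
      have p2 := hκ.trans h2
      gcongr
    _ ≤ _ := mul_le_mul_of_nonneg_left e1 (hκ.trans h1)

theorem prob_HC_diff_mul_le {n a : ℤ} (ha : 1 ≤ a) (han : 2 * a + 1 ≤ n) {c : ℝ} (hc : 0 < c)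
    (harch : ∀ x, c ≤ μ.real (Arch x (-n) a)) :
    c * μ.real (HC true (-n) n (-n + 1) n \ HC true (-n) n (-n + a) n) ≤
      μ.real {ω | ∃ v, Pivotal n ω v ∧ v.2 ≤ -n + 2 * a + 1} := by
  have := hμ.1
  set Λ := rect (-n) n (-n + 1) n with hΛ
  have hΛfin : Λ.Finite := finite_rect _ _ _ _
  set K := cluster false Λ (row n) with hK
  obtain ⟨I, hI⟩ := exists_finset_cluster false hΛfin (row n)
  let G : Set (Set Site) := {k | (∀ v ∈ k, v ∈ rect (-n) n (-n + 2) n ∧ v ∈ Λ) ∧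
    ∃ s t, s.2 = -n + a ∧ t.2 = n ∧ Conn k s t}
  have hΛsub : Λ ⊆ rect (-n) n (-n) n :=
    fun v hv => ⟨hv.1, hv.2.1, by have := hv.2.2.1; omega, hv.2.2.2⟩
  let F : Set Site → Set Site := fun k => rect (-n) n (-n) n \ hull Λ (row n) k
  have h1 : μ.real {ω | K ω ∈ G ∧ ω ∈ (Set.univ : Set Config)} ≤
      1 / c * μ.real {ω | K ω ∈ G ∧ ω ∈ Reach n (2 * a) (F (K ω)) (hull Λ (row n) (K ω))} := by
    refine prob_explore_le hμ hI G (fun k => hull Λ (row n) k) F (fun _ => Set.univ)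
      (fun k => Reach n (2 * a) (F k) (hull Λ (row n) k)) (1 / c)
      (fun k _ => hΛfin.subset (hull_subset _ _ _))
      (fun k _ => (finite_rect (-n) n (-n) n).subset fun v hv => hv.1)
      (fun k _ => Set.disjoint_sdiff_right) (fun k _ => dep_cluster_eq _ _ _ _)
      (fun _ _ _ _ _ h => h) (fun k _ => dep_reach _ _ _ _) ?_
    rintro k ⟨hk, s, t, hs, ht, hst⟩
    rw [probReal_univ, one_div, ← div_eq_inv_mul, le_div_iff₀ hc, one_mul]
    refine (harch s.1).trans (prob_mono hμ (arch_subset_reach ha (by omega)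
      (fun v hv => (hk v hv).1)
      (fun v hv => ⟨(hk v hv).2, .inl hv⟩) (fun v hv => ?_) hs ht hst))
    have := hv.1.2.2.1
    omega
  have h2 : HC true (-n) n (-n + 1) n \ HC true (-n) n (-n + a) n ⊆
      {ω | K ω ∈ G ∧ ω ∈ (Set.univ : Set Config)} := by
    rintro ω ⟨hω, hω'⟩
    refine ⟨⟨fun v hv => ?_, ?_⟩, trivial⟩
    · have hvΛ := (mem_of_mem_cluster hv).1
      refine ⟨⟨hvΛ.1, hvΛ.2.1, ?_, hvΛ.2.2.2⟩, hvΛ⟩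
      by_contra! h
      have h' := hvΛ.2.2.1
      obtain ⟨t, ht, htv⟩ := hv
      exact not_HC_and_VC hω ⟨v, by rw [Set.mem_ofPred_eq]; omega, t, ht, htv.symm⟩
    · obtain ⟨s, hs, hs'⟩ := exists_mem_cluster (by omega) (by omega) hω'
      obtain ⟨t, ht, hts⟩ := hs
      have hsK : s ∈ K ω := ⟨t, ht, hts.mono fun v hv =>
        ⟨⟨hv.1.1, hv.1.2.1, by have := hv.1.2.2.1; omega, hv.1.2.2.2⟩, hv.2⟩⟩
      obtain ⟨t, ht, hts⟩ := conn_cluster hsK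
      exact ⟨s, t, hs', ht, hts.symm⟩
  have h3 : {ω | K ω ∈ G ∧ ω ∈ Reach n (2 * a) (F (K ω)) (hull Λ (row n) (K ω))} ⊆
      {ω | ∃ v, Pivotal n ω v ∧ v.2 ≤ -n + 2 * a + 1} := by
    rintro ω ⟨⟨hk, -⟩, hR⟩
    have hHC : ω ∈ HC true (-n) n (-n + 1) n := by
      refine HC_of_forall_mem_cluster (by omega) (by omega) fun s hs hs' => ?_
      have := (hk s hs).1.2.2.1
      omega
    refine pivotal_of_reach (by omega) (fun v hv => (hk v hv).1.2.2.1) ?_ hR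
    exact cross_mono hΛsub subset_rfl subset_rfl hHC
  have h4 := (prob_mono hμ h2).trans (h1.trans (mul_le_mul_of_nonneg_left (prob_mono hμ h3)
    (by positivity)))
  rwa [one_div, ← div_eq_inv_mul, le_div_iff₀ hc, mul_comm] at h4

end

theorem exists_le_prob_pivotal_of_six_le : ∃ c > (0 : ℝ), ∀ μ, IsBernoulliHalf μ → ∀ n m : ℕ,
    6 ≤ m → m ≤ n → c * m / n ≤ μ.real {ω | ∃ v, Pivotal n ω v ∧ v.2 < -n + m} := by
  obtain ⟨κ, hκ, hcross⟩ := exists_le_crossProb 3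
  refine ⟨κ ^ 4 / 42, by positivity, fun μ hμ n m hm hmn => ?_⟩
  obtain ⟨d, hd, hdm, hmd⟩ : ∃ d : ℕ, 1 ≤ d ∧ 2 * d + 4 ≤ m ∧ m ≤ 7 * d :=
    ⟨m / 2 - 2, by omega, by omega, by omega⟩
  have harch : ∀ x, κ ^ 3 ≤ μ.real (Arch x (-n) (d + 1)) := fun x =>
    prob_arch_ge hμ hκ.le (by omega) (hcross μ hμ _ _ (by omega) (by omega) (by omega))
      (hcross μ hμ _ _ (by omega) (by omega) (by omega)) x (-n)
  have h1 := prob_HC_diff_mul_le hμ (n := n) (by omega) (by omega) (pow_pos hκ 3) harch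
  rw [prob_HC_diff hμ _ _ (by omega)] at h1
  have r1 : (n : ℤ) - -n = 2 * n := by ring
  have r2 : (n : ℤ) - (-n + 1) = 2 * n - (d + 1) + d := by ring
  have r3 : (n : ℤ) - (-n + (d + 1)) = 2 * n - (d + 1) := by ring
  rw [r1, r2, r3] at h1
  have hJ : 2 * n < (2 * n / d + 1) * d := by
    have := Nat.lt_div_mul_add (a := 2 * n) (b := d) (by omega)
    linarith
  have hJ' : (2 * n / d + 1) * d ≤ 3 * n := by
    have := Nat.div_mul_le_self (2 * n) d
    rw [add_mul]
    omega
  set J := 2 * n / d + 1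
  have h2 := crossProb_mul_le hμ (w := 2 * n) (h := 2 * n - (d + 1)) (d := d) (J := J)
    (by omega) (by
      zify at hJ
      omega)
  have h3 := hcross μ hμ (2 * n - (d + 1)) (2 * n) (by omega) (by omega) (by omega)
  have h4 := crossProb_mono_right hμ (w := 2 * n) (h := 2 * n - (d + 1)) (h' := 2 * n) (by omega)
  rw [crossProb_self hμ (by omega)] at h4
  have h5 : μ.real {ω | ∃ v, Pivotal n ω v ∧ v.2 ≤ -n + 2 * (d + 1) + 1} ≤
      μ.real {ω | ∃ v, Pivotal n ω v ∧ v.2 < -n + m} :=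
    prob_mono hμ fun ω ⟨v, hv, h⟩ => ⟨v, hv, by omega⟩
  have h6 := h1.trans h5
  set f := crossProb μ (2 * n) (2 * n - (d + 1))
  set D := crossProb μ (2 * n) (2 * n - (d + 1) + d) - f
  have h7 : κ / 2 ≤ J * D := by nlinarith
  have hD : 0 ≤ D := by
    by_contra! h
    have : (0 : ℝ) ≤ J := J.cast_nonneg
    nlinarith
  have h8 : κ / 2 * d ≤ 3 * n * D := by
    have hJr : (J : ℝ) * d ≤ 3 * n := by exact_mod_cast hJ'
    calc κ / 2 * d ≤ J * D * d := by gcongr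
      _ = J * d * D := by ring
      _ ≤ 3 * n * D := by gcongr
  have hmd' : (m : ℝ) ≤ 7 * d := by exact_mod_cast hmd
  have hn : (0 : ℝ) < n := by exact_mod_cast (by omega : 0 < n)
  refine le_trans ?_ h6
  rw [div_le_iff₀ hn]
  calc κ ^ 4 / 42 * m ≤ κ ^ 4 / 42 * (7 * d) := by gcongr
    _ = κ ^ 3 / 3 * (κ / 2 * d) := by ring
    _ ≤ κ ^ 3 / 3 * (3 * n * D) := by gcongr
    _ = κ ^ 3 * D * n := by ring

theorem exists_le_prob_pivotal : ∃ c > (0 : ℝ), ∀ μ, IsBernoulliHalf μ → ∀ n m : ℕ, 1 ≤ m →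
    m ≤ n → c * m / n ≤ μ.real {ω | ∃ v, Pivotal n ω v ∧ v.2 < -n + m} := by
  obtain ⟨c, hc, h⟩ := exists_le_prob_pivotal_of_six_le
  refine ⟨min c (1 / 400), by positivity, fun μ hμ n m hm hmn => ?_⟩
  rcases le_or_gt 6 m with h6 | h6
  · refine le_trans ?_ (h μ hμ n m h6 hmn)
    gcongr
    exact min_le_left _ _
  · have h1 := prob_pivotal_bottom_ge_inv hμ (n := n) (by omega)
    refine le_trans ?_ (h1.trans (prob_mono hμ fun ω ⟨v, hv, h⟩ => ⟨v, hv, by omega⟩))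
    have hm5 : (m : ℝ) ≤ 5 := by exact_mod_cast (by omega : m ≤ 5)
    calc min c (1 / 400) * m / n ≤ 1 / 400 * 5 / n := by
          gcongr
          exact min_le_right _ _
      _ = 1 / (80 * n) := by
          field_simp
          norm_num

/-- There exist constants `0 < c ≤ C < ∞` such that for every integer `n ≥ 1`
and every integer `1 ≤ m ≤ n`, `c·m/n ≤ P(M_n < m) ≤ C·m/n`. -/
theorem statement0 :
    ∃ c C : ℝ≥0∞, 0 < c ∧ c ≤ C ∧ C < ⊤ ∧
      ∀ μ : Measure Config, IsBernoulliHalf μ →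
        ∀ n m : ℕ, 1 ≤ n → 1 ≤ m → m ≤ n →
          c * m / n ≤ μ {ω | Mn n ω < m} ∧
            μ {ω | Mn n ω < m} ≤ C * m / n := by
  obtain ⟨c, hc, hlower⟩ := exists_le_prob_pivotal
  obtain ⟨C, hupper⟩ := exists_prob_pivotal_le
  refine ⟨.ofReal c, .ofReal (max C c), ENNReal.ofReal_pos.2 hc,
    ENNReal.ofReal_le_ofReal (le_max_right _ _), ENNReal.ofReal_lt_top,
    fun μ hμ n m hn hm hmn => ?_⟩
  have := hμ.1
  have hn' : (0 : ℝ) < n := by exact_mod_cast hn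
  have hcast : ∀ b : ℝ, 0 ≤ b → ENNReal.ofReal b * m / n = ENNReal.ofReal (b * m / n) := by
    intro b hb
    rw [ENNReal.ofReal_div_of_pos hn', ENNReal.ofReal_mul hb, ENNReal.ofReal_natCast,
      ENNReal.ofReal_natCast]
  simp only [Mn_lt_iff (show m ≤ 2 * n by omega)]
  rw [hcast c hc.le, hcast _ (hc.le.trans (le_max_right _ _)), ← ofReal_measureReal]
  refine ⟨ENNReal.ofReal_le_ofReal (hlower μ hμ n m hm hmn), ENNReal.ofReal_le_ofReal ?_⟩
  refine (hupper μ hμ n m hm hmn).trans ?_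
  gcongr
  exact le_max_left _ _
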